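/- arXiv:2001.11740 — 3 statements merged into one kernel-verified Lean document; each statement's English description precedes it below -/
import Mathlib

section
/- EXP-QPT holds if and only if lim_{j→∞} λ_j = 0, lim_{j→∞} γ_j = 0, and B := limsup_{ε→0⁺} d(ε)·log j(ε) / ((log d(ε))·log log ε⁻¹) < ∞. Moreover, if these three conditions hold, then the exponent t* of EXP-QPT equals B. -/
open Filter Real Set Topology
open scoped ENNReal NNReal

noncomputable section

/-- The weighted eigenvalues `λ_{k,j}`: `1` if `j = 1`, and `γ_k · λ_j` if `j ≥ 2`. -/
def lamKJ (γ lam : ℕ → ℝ) (k j : ℕ) : ℝ := if j = 1 then 1 else γ k * lam j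

/-- The information complexity `n(ε,d)`: the extended-natural cardinality of the set of
`d`-tuples of positive integers `(n_1,…,n_d)` with `λ_{1,n_1} ⋯ λ_{d,n_d} > ε²`. -/
def infoN (γ lam : ℕ → ℝ) (ε : ℝ) (d : ℕ) : ℕ∞ :=
  {n : Fin d → ℕ | (∀ i, 1 ≤ n i) ∧ ε ^ 2 < ∏ i, lamKJ γ lam (i.1 + 1) (n i)}.encard

/-- EXP-SPT with a given exponent `p`: there is `C ≥ 0` with
`n(ε,d) ≤ C (1 + log ε⁻¹)^p` for all `d ≥ 1` and `ε ∈ (0,1]`. -/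
def ExpSPTwith (γ lam : ℕ → ℝ) (p : ℝ) : Prop :=
  ∃ C : ℝ, 0 ≤ C ∧ ∀ d : ℕ, 1 ≤ d → ∀ ε : ℝ, 0 < ε → ε ≤ 1 →
    (infoN γ lam ε d : ℝ≥0∞) ≤ ENNReal.ofReal (C * (1 + Real.log ε⁻¹) ^ p)

/-- Exponential strong polynomial tractability. -/
def ExpSPT (γ lam : ℕ → ℝ) : Prop := ∃ p : ℝ, 0 ≤ p ∧ ExpSPTwith γ lam p

/-- Exponential polynomial tractability: there are `C, q, p ≥ 0` with
`n(ε,d) ≤ C d^q (1 + log ε⁻¹)^p` for all `d ≥ 1` and `ε ∈ (0,1]`. -/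
def ExpPT (γ lam : ℕ → ℝ) : Prop :=
  ∃ C q p : ℝ, 0 ≤ C ∧ 0 ≤ q ∧ 0 ≤ p ∧ ∀ d : ℕ, 1 ≤ d → ∀ ε : ℝ, 0 < ε → ε ≤ 1 →
    (infoN γ lam ε d : ℝ≥0∞) ≤ ENNReal.ofReal (C * (d : ℝ) ^ q * (1 + Real.log ε⁻¹) ^ p)

/-- EXP-QPT with a given exponent `t`. -/
def ExpQPTwith (γ lam : ℕ → ℝ) (t : ℝ) : Prop :=
  ∃ C : ℝ, 0 ≤ C ∧ ∀ d : ℕ, 1 ≤ d → ∀ ε : ℝ, 0 < ε → ε ≤ 1 →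
    (infoN γ lam ε d : ℝ≥0∞) ≤
      ENNReal.ofReal (C * Real.exp (t * (1 + Real.log d) * (1 + Real.log (1 + Real.log ε⁻¹))))

/-- Exponential quasi-polynomial tractability. -/
def ExpQPT (γ lam : ℕ → ℝ) : Prop := ∃ t : ℝ, 0 ≤ t ∧ ExpQPTwith γ lam t

/-- Exponential `(s,t)`-weak tractability:
`log max(1, n(ε,d)) / (d^t + (1 + log ε⁻¹)^s) → 0` as `d + ε⁻¹ → ∞`
(in particular `n(ε,d)` is finite for all such `d, ε`). -/
def ExpSTWT (γ lam : ℕ → ℝ) (s t : ℝ) : Prop :=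
  ∀ δ : ℝ, 0 < δ → ∃ T : ℝ, ∀ d : ℕ, 1 ≤ d → ∀ ε : ℝ, 0 < ε → ε ≤ 1 →
    T ≤ (d : ℝ) + ε⁻¹ →
    ∃ N : ℕ, infoN γ lam ε d = (N : ℕ∞) ∧
      Real.log (max 1 (N : ℝ)) / ((d : ℝ) ^ t + (1 + Real.log ε⁻¹) ^ s) < δ

/-- `j(ε) = max { j ≥ 1 : λ_j > ε² }` (a well-defined maximum when `λ_j → 0`). -/
def jEps (lam : ℕ → ℝ) (ε : ℝ) : ℕ := sSup {j : ℕ | 1 ≤ j ∧ ε ^ 2 < lam j}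

/-- `d(ε) = max { d ≥ 1 : γ_d > ε² }`, with `d(ε) = 0` if `γ_1 ≤ ε²`
(a well-defined maximum when `γ_d → 0`). -/
def dEps (γ : ℕ → ℝ) (ε : ℝ) : ℕ := sSup {d : ℕ | 1 ≤ d ∧ ε ^ 2 < γ d}

theorem tendsto_zero_of_antitoneOn_Ici {f : ℕ → ℝ} (hf : AntitoneOn f (Set.Ici 1))
    (h0 : ∀ j, 1 ≤ j → 0 ≤ f j) (h : ∀ g : ℝ, 0 < g → ∃ j, 1 ≤ j ∧ f j < g) :
    Tendsto f atTop (nhds 0) := by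
  rw [Metric.tendsto_atTop]
  intro g hg
  obtain ⟨N, hN, hNg⟩ := h g hg
  refine ⟨N, fun n hn => ?_⟩
  have h1n : 1 ≤ n := hN.trans hn
  rw [Real.dist_eq, sub_zero, abs_of_nonneg (h0 n h1n)]
  exact (hf hN h1n hn).trans_lt hNg

theorem bddAbove_setOf_lt {f : ℕ → ℝ} (hf : Tendsto f atTop (nhds 0)) {ε : ℝ} (hε : 0 < ε) :
    BddAbove {j : ℕ | 1 ≤ j ∧ ε ^ 2 < f j} := by
  have h : ∀ᶠ j in atTop, f j < ε ^ 2 := hf.eventually_lt_const (by positivity)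
  obtain ⟨N, hN⟩ := eventually_atTop.1 h
  refine ⟨N, fun j hj => ?_⟩
  by_contra! hlt
  exact (hN j hlt.le).not_gt hj.2

theorem le_jEps {f : ℕ → ℝ} (hf : Tendsto f atTop (nhds 0)) {ε : ℝ} (hε : 0 < ε) {j : ℕ}
    (hj : 1 ≤ j) (h : ε ^ 2 < f j) : j ≤ jEps f ε :=
  le_csSup (bddAbove_setOf_lt hf hε) ⟨hj, h⟩

theorem sq_lt_apply_jEps {f : ℕ → ℝ} (hf : Tendsto f atTop (nhds 0)) {ε : ℝ} (hε : 0 < ε)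
    {j : ℕ} (hj : 1 ≤ j) (h : ε ^ 2 < f j) : ε ^ 2 < f (jEps f ε) :=
  (Nat.sSup_mem (s := {j : ℕ | 1 ≤ j ∧ ε ^ 2 < f j}) ⟨j, hj, h⟩ (bddAbove_setOf_lt hf hε)).2

theorem eventually_le_jEps {f : ℕ → ℝ} (hf : Tendsto f atTop (nhds 0)) {j : ℕ} (hj : 1 ≤ j)
    (h : 0 < f j) :
    ∀ᶠ ε in nhdsWithin (0 : ℝ) (Set.Ioi 0), j ≤ jEps f ε ∧ ε ^ 2 < f (jEps f ε) := by
  have hsq : Tendsto (fun ε : ℝ => ε ^ 2) (nhdsWithin (0 : ℝ) (Set.Ioi 0)) (nhds 0) := by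
    have : Tendsto (fun ε : ℝ => ε ^ 2) (nhds 0) (nhds (0 ^ 2)) := (continuous_pow 2).tendsto 0
    rw [zero_pow two_ne_zero] at this
    exact this.mono_left nhdsWithin_le_nhds
  filter_upwards [hsq.eventually_lt_const h, self_mem_nhdsWithin] with ε h1 h2
  exact ⟨le_jEps hf h2 hj h1, sq_lt_apply_jEps hf h2 hj h1⟩

theorem infoN_anti (γ lam : ℕ → ℝ) {ε ε' : ℝ} (hε : 0 ≤ ε) (h : ε ≤ ε') (d : ℕ) :
    infoN γ lam ε' d ≤ infoN γ lam ε d := by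
  refine Set.encard_le_encard fun n hn => ⟨hn.1, lt_of_le_of_lt ?_ hn.2⟩
  gcongr

theorem pow_le_infoN {γ lam : ℕ → ℝ} {a : ℝ} (ha : 0 < a) (ha1 : a ≤ 1) {d j : ℕ} (hd : 1 ≤ d)
    (h : ∀ k m, 1 ≤ k → k ≤ d → 1 ≤ m → m ≤ j → a < lamKJ γ lam k m) :
    ((j ^ d : ℕ) : ℕ∞) ≤ infoN γ lam (a ^ d) d := by
  have hcard : (Fintype.piFinset fun _ : Fin d => Finset.Icc 1 j).card = j ^ d := by simp
  rw [← hcard, ← Set.encard_coe_eq_coe_finsetCard]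
  refine Set.encard_le_encard fun n hn => ?_
  simp only [Fintype.coe_piFinset, Finset.coe_Icc, Set.mem_pi, Set.mem_univ, Set.mem_Icc,
    true_imp_iff] at hn
  refine ⟨fun i => (hn i).1, ?_⟩
  calc (a ^ d) ^ 2 ≤ a ^ d := pow_le_of_le_one (by positivity) (pow_le_one₀ ha.le ha1) two_ne_zero
    _ = ∏ _i : Fin d, a := by simp
    _ < _ := by
      have : Nonempty (Fin d) := ⟨⟨0, hd⟩⟩
      exact Finset.prod_lt_prod_of_nonempty (fun _ _ => ha)
        (fun i _ => h _ _ (by omega) (by omega) (hn i).1 (hn i).2) Finset.univ_nonempty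

theorem ExpQPTwith.mul_log_le {γ lam : ℕ → ℝ} {t : ℝ} (h : ExpQPTwith γ lam t) :
    ∃ c : ℝ, ∀ a : ℝ, 0 < a → a ≤ 1 → ∀ d j : ℕ, 1 ≤ d → 1 ≤ j →
      (∀ k m, 1 ≤ k → k ≤ d → 1 ≤ m → m ≤ j → a < lamKJ γ lam k m) →
      d * Real.log j ≤
        c + t * (1 + Real.log d) * (1 + Real.log (1 + d * Real.log a⁻¹)) := by
  obtain ⟨C, hC, hb⟩ := h
  refine ⟨Real.log (C + 1), fun a ha ha1 d j hd hj hlt => ?_⟩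
  have h1 := hb d hd (a ^ d) (by positivity) (pow_le_one₀ ha.le ha1)
  have h2 : (((j ^ d : ℕ) : ℕ∞) : ℝ≥0∞) ≤ infoN γ lam (a ^ d) d := by
    exact_mod_cast pow_le_infoN ha ha1 hd hlt
  have h3 := h2.trans h1
  rw [← inv_pow, Real.log_pow] at h3
  set E := t * (1 + Real.log d) * (1 + Real.log (1 + d * Real.log a⁻¹))
  have h4 : ((j : ℝ) ^ d) ≤ C * Real.exp E := by
    rw [ENat.toENNReal_coe, ← ENNReal.ofReal_natCast,
      ENNReal.ofReal_le_ofReal_iff (by positivity)] at h3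
    exact_mod_cast h3
  have hj0 : (0 : ℝ) < j := by exact_mod_cast hj
  calc d * Real.log j = Real.log ((j : ℝ) ^ d) := (Real.log_pow _ _).symm
    _ ≤ Real.log ((C + 1) * Real.exp E) := by
      apply Real.log_le_log (by positivity)
      exact h4.trans (by gcongr; linarith)
    _ = _ := by rw [Real.log_mul (by positivity) (Real.exp_pos _).ne', Real.log_exp]

theorem infoN_le_pow {γ lam : ℕ → ℝ} (hlam1 : lam 1 = 1)
    (hlam_anti : AntitoneOn lam (Set.Ici 1)) (hlam_nonneg : ∀ j, 1 ≤ j → 0 ≤ lam j)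
    (hγ_pos : ∀ j, 1 ≤ j → 0 < γ j) (hγ_le : ∀ j, 1 ≤ j → γ j ≤ 1)
    (hl : Tendsto lam atTop (nhds 0)) (hg : Tendsto γ atTop (nhds 0)) {ε : ℝ} (hε : 0 < ε)
    (hε1 : ε < 1) (d : ℕ) :
    infoN γ lam ε d ≤ ((jEps lam ε ^ min d (dEps γ ε) : ℕ) : ℕ∞) := by
  have hj1 : 1 ≤ jEps lam ε := le_jEps hl hε le_rfl
    (by rw [hlam1]; exact pow_lt_one₀ hε.le hε1 two_ne_zero)
  have hlam_le : ∀ j, 1 ≤ j → lam j ≤ 1 := fun j hj =>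
    hlam1 ▸ hlam_anti (Set.mem_Ici.2 le_rfl) hj hj
  have hnn : ∀ k m, 1 ≤ k → 1 ≤ m → 0 ≤ lamKJ γ lam k m := by
    intro k m hk hm
    unfold lamKJ
    split_ifs
    · exact zero_le_one
    · exact mul_nonneg (hγ_pos k hk).le (hlam_nonneg m hm)
  have hle : ∀ k m, 1 ≤ k → 1 ≤ m → lamKJ γ lam k m ≤ 1 := by
    intro k m hk hm
    unfold lamKJ
    split_ifs
    · exact le_rfl
    · exact mul_le_one₀ (hγ_le k hk) (hlam_nonneg m hm) (hlam_le m hm)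
  set F : Finset (Fin d → ℕ) := Fintype.piFinset fun i : Fin d =>
    if i.1 < dEps γ ε then Finset.Icc 1 (jEps lam ε) else {1} with hF
  have hsub : {n : Fin d → ℕ | (∀ i, 1 ≤ n i) ∧ ε ^ 2 < ∏ i, lamKJ γ lam (i.1 + 1) (n i)} ⊆ F := by
    rintro n ⟨hn, hp⟩
    rw [Finset.mem_coe, hF, Fintype.mem_piFinset]
    intro i
    have hi : ε ^ 2 < lamKJ γ lam (i.1 + 1) (n i) := by
      refine hp.trans_le ?_
      rw [← Finset.mul_prod_erase _ _ (Finset.mem_univ i)]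
      exact mul_le_of_le_one_right (hnn _ _ (by omega) (hn i)) (Finset.prod_le_one
        (fun k _ => hnn _ _ (by omega) (hn k)) (fun k _ => hle _ _ (by omega) (hn k)))
    by_cases h1 : n i = 1
    · split_ifs
      · simp [h1, hj1]
      · simp [h1]
    · rw [lamKJ, if_neg h1] at hi
      have hgi : ε ^ 2 < γ (i.1 + 1) := hi.trans_le
        (mul_le_of_le_one_right (hγ_pos _ (by omega)).le (hlam_le _ (hn i)))
      have hli : ε ^ 2 < lam (n i) := hi.trans_le
        (mul_le_of_le_one_left (hlam_nonneg _ (hn i)) (hγ_le _ (by omega)))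
      have hD : i.1 + 1 ≤ dEps γ ε := le_jEps hg hε (by omega) hgi
      rw [if_pos (by omega), Finset.mem_Icc]
      exact ⟨hn i, le_jEps hl hε (hn i) hli⟩
  refine (Set.encard_le_encard hsub).trans ?_
  rw [Set.encard_coe_eq_coe_finsetCard, Nat.cast_le, hF, Fintype.card_piFinset]
  have hc : ∀ i : Fin d, (if i.1 < dEps γ ε then Finset.Icc 1 (jEps lam ε) else {1}).card =
      if i.1 < dEps γ ε then jEps lam ε else 1 := by
    intro i
    split_ifs <;> simp
  simp_rw [hc]
  rw [Finset.prod_ite, Finset.prod_const, Finset.prod_const_one, mul_one]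
  refine Nat.pow_le_pow_right hj1 (le_min ?_ ?_)
  · simpa using Finset.card_filter_le (Finset.univ : Finset (Fin d)) (fun i => i.1 < dEps γ ε)
  · rw [← Finset.card_map Fin.valEmbedding]
    conv_rhs => rw [← Finset.card_range (dEps γ ε)]
    refine Finset.card_le_card fun k hk => ?_
    simp only [Finset.mem_map, Finset.mem_filter, Fin.valEmbedding_apply] at hk
    obtain ⟨i, hi, rfl⟩ := hk
    exact Finset.mem_range.2 hi.2

theorem min_mul_log_le {d D : ℕ} (hd : 1 ≤ d) (hD : 1 ≤ D) :
    (min d D : ℕ) * Real.log D ≤ D * (1 + Real.log d) := by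
  have hd' : (1 : ℝ) ≤ d := by exact_mod_cast hd
  have hD' : (1 : ℝ) ≤ D := by exact_mod_cast hD
  have hlogd := Real.log_nonneg hd'
  rcases le_total D d with h | h
  · rw [min_eq_right h]
    have : Real.log D ≤ Real.log d := Real.log_le_log (by linarith) (by exact_mod_cast h)
    gcongr
    linarith
  · rw [min_eq_left h]
    have h' : (d : ℝ) ≤ D := by exact_mod_cast h
    have h1 : Real.log (D / d) ≤ D / d - 1 := Real.log_le_sub_one_of_pos (by positivity)
    rw [Real.log_div (by positivity) (by positivity)] at h1
    have h2 : (d : ℝ) * (Real.log D - Real.log d) ≤ d * (D / d - 1) := by gcongr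
    have h3 : (d : ℝ) * (D / d - 1) = D - d := by field_simp
    nlinarith

theorem eventually_quadratic_lt_exp (c A B K : ℝ) :
    ∀ᶠ x : ℝ in atTop, c + A * (1 + x) * (B + K * x) < Real.exp x * Real.log 2 := by
  have h2 : 0 < Real.log 2 := Real.log_pos one_lt_two
  have hpow : ∀ n : ℕ, Tendsto (fun x : ℝ => x ^ n * Real.exp (-x)) atTop (nhds 0) :=
    Real.tendsto_pow_mul_exp_neg_atTop_nhds_zero
  have hlim := (((hpow 0).const_mul (c + A * B)).add ((hpow 1).const_mul (A * B + A * K))).add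
    ((hpow 2).const_mul (A * K))
  simp only [mul_zero, add_zero] at hlim
  filter_upwards [hlim.eventually_lt_const h2] with x hx
  have he : Real.exp x * Real.exp (-x) = 1 := by rw [← Real.exp_add]; simp
  calc c + A * (1 + x) * (B + K * x)
      = (c + A * (1 + x) * (B + K * x)) * (Real.exp x * Real.exp (-x)) := by rw [he, mul_one]
    _ = Real.exp x * ((c + A * B) * (x ^ 0 * Real.exp (-x)) +
          (A * B + A * K) * (x ^ 1 * Real.exp (-x)) + A * K * (x ^ 2 * Real.exp (-x))) := by ring
    _ < Real.exp x * Real.log 2 := mul_lt_mul_of_pos_left hx (Real.exp_pos x)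

theorem tendsto_log_log_inv :
    Tendsto (fun ε : ℝ => Real.log (Real.log ε⁻¹)) (nhdsWithin (0 : ℝ) (Set.Ioi 0)) atTop :=
  Real.tendsto_log_atTop.comp (Real.tendsto_log_atTop.comp tendsto_inv_nhdsGT_zero)

theorem tendsto_log_dEps {γ : ℕ → ℝ} (hγ_pos : ∀ j, 1 ≤ j → 0 < γ j)
    (hg : Tendsto γ atTop (nhds 0)) :
    Tendsto (fun ε => Real.log (dEps γ ε)) (nhdsWithin (0 : ℝ) (Set.Ioi 0)) atTop := by
  refine Real.tendsto_log_atTop.comp (tendsto_natCast_atTop_atTop.comp ?_)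
  refine tendsto_atTop.2 fun N => ?_
  filter_upwards [eventually_le_jEps hg (j := N + 1) (by omega) (hγ_pos _ (by omega))] with ε hε
  exact (Nat.le_succ N).trans hε.1

theorem ExpQPTwith.tendsto_lam {γ lam : ℕ → ℝ} {t : ℝ} (h : ExpQPTwith γ lam t)
    (hlam_anti : AntitoneOn lam (Set.Ici 1)) (hlam_nonneg : ∀ j, 1 ≤ j → 0 ≤ lam j)
    (hγ_pos : ∀ j, 1 ≤ j → 0 < γ j) :
    Tendsto lam atTop (nhds 0) := by
  refine tendsto_zero_of_antitoneOn_Ici hlam_anti hlam_nonneg ?_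
  by_contra! hcon
  obtain ⟨g, hg, hgl⟩ := hcon
  obtain ⟨c, hc⟩ := h.mul_log_le
  have hγ1 := hγ_pos 1 le_rfl
  set a := min (γ 1 * g) 1 / 2 with ha
  have hm : 0 < min (γ 1 * g) 1 := lt_min (by positivity) one_pos
  have hm1 := min_le_left (γ 1 * g) 1
  have hm2 := min_le_right (γ 1 * g) 1
  have hlog : Tendsto (fun j : ℕ => Real.log j) atTop atTop :=
    Real.tendsto_log_atTop.comp tendsto_natCast_atTop_atTop
  obtain ⟨j, hj, hj1⟩ := ((hlog.eventually_gt_atTop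
    (c + t * (1 + Real.log (1 : ℕ)) * (1 + Real.log (1 + (1 : ℕ) * Real.log a⁻¹)))).and
    (eventually_ge_atTop 1)).exists
  have := hc a (by positivity) (by linarith) 1 j le_rfl hj1 (fun k m hk hk1 hm1' _ => by
    obtain rfl : k = 1 := by omega
    unfold lamKJ
    split_ifs
    · linarith
    · have := mul_le_mul_of_nonneg_left (hgl m hm1') hγ1.le
      linarith)
  simp only [Nat.cast_one, one_mul] at this hj
  linarith

theorem ExpQPTwith.tendsto_gamma {γ lam : ℕ → ℝ} {t : ℝ} (h : ExpQPTwith γ lam t) (ht : 0 ≤ t)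
    (hlam2 : 0 < lam 2) (hγ_anti : AntitoneOn γ (Set.Ici 1)) (hγ_pos : ∀ j, 1 ≤ j → 0 < γ j) :
    Tendsto γ atTop (nhds 0) := by
  refine tendsto_zero_of_antitoneOn_Ici hγ_anti (fun j hj => (hγ_pos j hj).le) ?_
  by_contra! hcon
  obtain ⟨g, hg, hgl⟩ := hcon
  obtain ⟨c, hc⟩ := h.mul_log_le
  set a := min (g * lam 2) 1 / 2 with ha
  have hm : 0 < min (g * lam 2) 1 := lt_min (by positivity) one_pos
  have hm1 := min_le_left (g * lam 2) 1
  have hm2 := min_le_right (g * lam 2) 1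
  have hA : 0 ≤ Real.log a⁻¹ := Real.log_nonneg ((one_le_inv₀ (by positivity)).2 (by linarith))
  have hlog : Tendsto (fun j : ℕ => Real.log j) atTop atTop :=
    Real.tendsto_log_atTop.comp tendsto_natCast_atTop_atTop
  obtain ⟨d, hd, hd1⟩ := ((hlog.eventually (eventually_quadratic_lt_exp c t
    (1 + Real.log (1 + Real.log a⁻¹)) 1)).and (eventually_ge_atTop 1)).exists
  have hd' : (1 : ℝ) ≤ d := by exact_mod_cast hd1
  have hlogd := Real.log_nonneg hd'
  have := hc a (by positivity) (by linarith) d 2 hd1 one_le_two (fun k m hk hk1 hm1' hm2' => by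
    unfold lamKJ
    split_ifs
    · linarith
    · obtain rfl : m = 2 := by omega
      have := mul_le_mul_of_nonneg_right (hgl k hk) hlam2.le
      linarith)
  have hle : Real.log (1 + d * Real.log a⁻¹) ≤ Real.log (1 + Real.log a⁻¹) + Real.log d := by
    rw [← Real.log_mul (by positivity) (by positivity)]
    apply Real.log_le_log (by positivity)
    nlinarith
  rw [Real.exp_log (by positivity)] at hd
  have : t * (1 + Real.log d) * (1 + Real.log (1 + d * Real.log a⁻¹)) ≤
      t * (1 + Real.log d) * (1 + Real.log (1 + Real.log a⁻¹) + 1 * Real.log d) :=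
    mul_le_mul_of_nonneg_left (by linarith) (by positivity)
  push_cast at *
  linarith

theorem ExpQPTwith.eventually_le {γ lam : ℕ → ℝ} {t : ℝ} (h : ExpQPTwith γ lam t) (ht : 0 ≤ t)
    (hlam_anti : AntitoneOn lam (Set.Ici 1)) (hlam2 : 0 < lam 2)
    (hγ_anti : AntitoneOn γ (Set.Ici 1)) (hγ_pos : ∀ j, 1 ≤ j → 0 < γ j)
    (hl : Tendsto lam atTop (nhds 0)) (hg : Tendsto γ atTop (nhds 0)) {s : ℝ} (hs : t < s) :
    ∀ᶠ ε in nhdsWithin (0 : ℝ) (Set.Ioi 0), (dEps γ ε : ℝ) * Real.log (jEps lam ε) /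
      (Real.log (dEps γ ε) * Real.log (Real.log ε⁻¹)) ≤ s := by
  obtain ⟨c, hc⟩ := h.mul_log_le
  obtain ⟨K, κ, hK, hκ, hKs⟩ : ∃ K κ : ℝ, 0 < K ∧ K⁻¹ = κ ∧ t * (1 + κ) < s := by
    refine ⟨(t + 1) / (s - t), _, div_pos (by linarith) (by linarith), inv_div _ _, ?_⟩
    have : t * ((s - t) / (t + 1)) < s - t := by
      rw [mul_div_assoc', div_lt_iff₀ (by linarith)]
      nlinarith
    linarith
  have hx := tendsto_log_dEps hγ_pos hg
  have hy := tendsto_log_log_inv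
  have hlim : Tendsto (fun ε => c * (Real.log (dEps γ ε))⁻¹ * (Real.log (Real.log ε⁻¹))⁻¹ +
      t * ((Real.log (dEps γ ε))⁻¹ + 1) * (5 * (Real.log (Real.log ε⁻¹))⁻¹ + (1 + κ)))
      (nhdsWithin (0 : ℝ) (Set.Ioi 0)) (nhds (c * 0 * 0 + t * (0 + 1) * (5 * 0 + (1 + κ)))) :=
    ((hx.inv_tendsto_atTop.const_mul c).mul hy.inv_tendsto_atTop).add
      (((hx.inv_tendsto_atTop.add_const 1).const_mul t).mul
        ((hy.inv_tendsto_atTop.const_mul 5).add_const (1 + κ)))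
  have hlt1 : ∀ᶠ ε : ℝ in nhdsWithin (0 : ℝ) (Set.Ioi 0), ε < 1 :=
    (eventually_lt_nhds one_pos).filter_mono nhdsWithin_le_nhds
  have hL : Tendsto (fun ε : ℝ => Real.log ε⁻¹) (nhdsWithin (0 : ℝ) (Set.Ioi 0)) atTop :=
    Real.tendsto_log_atTop.comp tendsto_inv_nhdsGT_zero
  filter_upwards [hlim.eventually_lt_const (by simpa using hKs),
    hx.eventually (eventually_quadratic_lt_exp c t 5 (1 + K)),
    hx.eventually_gt_atTop 0, hy.eventually_gt_atTop 0, hL.eventually_ge_atTop 1,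
    eventually_le_jEps hl one_le_two hlam2, eventually_le_jEps hg le_rfl (hγ_pos 1 le_rfl),
    self_mem_nhdsWithin, hlt1] with ε hlt hexp hx0 hy0 hL1 hj hd hε hε1
  change 1 ≤ dEps γ ε ∧ ε ^ 2 < γ (dEps γ ε) at hd
  rw [Set.mem_Ioi] at hε
  have hε2 : 0 < ε ^ 2 := by positivity
  have hd' : (1 : ℝ) ≤ dEps γ ε := by exact_mod_cast hd.1
  have hj' : (2 : ℝ) ≤ jEps lam ε := by exact_mod_cast hj.1
  have hkey := hc (ε ^ 4) (by positivity) (pow_le_one₀ hε.le hε1.le) (dEps γ ε) (jEps lam ε)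
    hd.1 (by omega) (fun k m hk hkd hm hmj => by
      unfold lamKJ
      split_ifs
      · exact pow_lt_one₀ hε.le hε1 (by norm_num)
      · have h1 : ε ^ 2 < γ k := hd.2.trans_le (hγ_anti hk hd.1 hkd)
        have h2 : ε ^ 2 < lam m := hj.2.trans_le
          (hlam_anti hm (hm.trans hmj) hmj)
        calc ε ^ 4 = ε ^ 2 * ε ^ 2 := by ring
          _ < γ k * lam m := mul_lt_mul'' h1 h2 hε2.le hε2.le)
  rw [← inv_pow, Real.log_pow] at hkey
  set D : ℝ := (dEps γ ε : ℝ)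
  set J : ℝ := (jEps lam ε : ℝ)
  set L := Real.log ε⁻¹
  have hbound : Real.log (1 + D * ((4 : ℕ) * L)) ≤ 4 + Real.log D + Real.log L := by
    have h5 : Real.log 5 ≤ 5 - 1 := Real.log_le_sub_one_of_pos (by norm_num)
    have : Real.log (1 + D * ((4 : ℕ) * L)) ≤ Real.log (5 * D * L) := by
      apply Real.log_le_log (by positivity)
      push_cast
      nlinarith
    rw [Real.log_mul (by positivity) (by positivity), Real.log_mul (by positivity)
      (by positivity)] at this
    linarith
  have hxK : Real.log D ≤ κ * Real.log L := by
    rw [← hκ, inv_mul_eq_div, le_div_iff₀ hK]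
    by_contra! hcon
    rw [Real.exp_log (by positivity)] at hexp
    have h1 : D * Real.log 2 ≤ D * Real.log J := by
      gcongr
    have h2 : t * (1 + Real.log D) * (1 + Real.log (1 + D * ((4 : ℕ) * L))) ≤
        t * (1 + Real.log D) * (5 + (1 + K) * Real.log D) :=
      mul_le_mul_of_nonneg_left (by linarith) (by positivity)
    linarith
  have hfin : D * Real.log J ≤
      c + t * (1 + Real.log D) * (5 + (1 + κ) * Real.log L) := by
    have := mul_le_mul_of_nonneg_left
      (show 1 + Real.log (1 + D * ((4 : ℕ) * L)) ≤ 5 + (1 + κ) * Real.log L by linarith)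
      (show 0 ≤ t * (1 + Real.log D) by positivity)
    linarith
  refine (div_le_div_of_nonneg_right hfin (by positivity)).trans (le_trans (le_of_eq ?_) hlt.le)
  field_simp

theorem eventually_nonneg_ratio {γ lam : ℕ → ℝ} (hγ_pos : ∀ j, 1 ≤ j → 0 < γ j)
    (hg : Tendsto γ atTop (nhds 0)) :
    ∀ᶠ ε in nhdsWithin (0 : ℝ) (Set.Ioi 0), 0 ≤ (dEps γ ε : ℝ) * Real.log (jEps lam ε) /
      (Real.log (dEps γ ε) * Real.log (Real.log ε⁻¹)) := by
  filter_upwards [(tendsto_log_dEps hγ_pos hg).eventually_gt_atTop 0,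
    tendsto_log_log_inv.eventually_gt_atTop 0] with ε h1 h2
  have := Real.log_natCast_nonneg (jEps lam ε)
  positivity

theorem expQPTwith_of_eventually_le {γ lam : ℕ → ℝ} (hlam1 : lam 1 = 1)
    (hlam_anti : AntitoneOn lam (Set.Ici 1)) (hlam_nonneg : ∀ j, 1 ≤ j → 0 ≤ lam j)
    (hγ_pos : ∀ j, 1 ≤ j → 0 < γ j) (hγ_le : ∀ j, 1 ≤ j → γ j ≤ 1)
    (hl : Tendsto lam atTop (nhds 0)) (hg : Tendsto γ atTop (nhds 0)) {s : ℝ} (hs : 0 ≤ s)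
    (h : ∀ᶠ ε in nhdsWithin (0 : ℝ) (Set.Ioi 0), (dEps γ ε : ℝ) * Real.log (jEps lam ε) /
      (Real.log (dEps γ ε) * Real.log (Real.log ε⁻¹)) ≤ s) :
    ExpQPTwith γ lam s := by
  have hlt1 : ∀ᶠ ε : ℝ in nhdsWithin (0 : ℝ) (Set.Ioi 0), ε < 1 :=
    (eventually_lt_nhds one_pos).filter_mono nhdsWithin_le_nhds
  have hL : Tendsto (fun ε : ℝ => Real.log ε⁻¹) (nhdsWithin (0 : ℝ) (Set.Ioi 0)) atTop :=
    Real.tendsto_log_atTop.comp tendsto_inv_nhdsGT_zero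
  have hsmall : ∀ᶠ ε : ℝ in nhdsWithin (0 : ℝ) (Set.Ioi 0), ∀ d : ℕ, 1 ≤ d →
      ((jEps lam ε ^ min d (dEps γ ε) : ℕ) : ℝ) ≤
        Real.exp (s * (1 + Real.log d) * (1 + Real.log (1 + Real.log ε⁻¹))) := by
    filter_upwards [h, (tendsto_log_dEps hγ_pos hg).eventually_gt_atTop 0,
      tendsto_log_log_inv.eventually_gt_atTop 0, hL.eventually_ge_atTop 1,
      eventually_le_jEps hl le_rfl (by rw [hlam1]; exact one_pos),
      eventually_le_jEps hg le_rfl (hγ_pos 1 le_rfl)] with ε hε hx0 hy0 hL1 hj hd d hd1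
    change 1 ≤ dEps γ ε ∧ _ at hd
    have hj0 : (0 : ℝ) < jEps lam ε := by exact_mod_cast hj.1
    have hD0 : (0 : ℝ) < dEps γ ε := by exact_mod_cast hd.1
    have hlogj := Real.log_natCast_nonneg (jEps lam ε)
    have hlogd := Real.log_natCast_nonneg d
    rw [div_le_iff₀ (by positivity)] at hε
    push_cast
    rw [← Real.log_le_iff_le_exp (by positivity), Real.log_pow]
    have hm := min_mul_log_le hd1 hd.1
    set M : ℝ := ((min d (dEps γ ε) : ℕ) : ℝ)
    have hM : 0 ≤ M := Nat.cast_nonneg _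
    set D : ℝ := (dEps γ ε : ℝ)
    set J : ℝ := (jEps lam ε : ℝ)
    set L := Real.log ε⁻¹
    have h1 : D * (M * Real.log J) ≤ D * (s * (1 + Real.log d) * Real.log L) :=
      calc D * (M * Real.log J) = M * (D * Real.log J) := by ring
        _ ≤ M * (s * (Real.log D * Real.log L)) := by gcongr
        _ = s * Real.log L * (M * Real.log D) := by ring
        _ ≤ s * Real.log L * (D * (1 + Real.log d)) := by gcongr
        _ = _ := by ring
    refine (le_of_mul_le_mul_left h1 hD0).trans ?_
    have : Real.log L ≤ Real.log (1 + L) := Real.log_le_log (by positivity) (by linarith)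
    gcongr
    linarith
  obtain ⟨ε₀, hε₀, hsm⟩ := mem_nhdsGT_iff_exists_Ioc_subset.1 (hsmall.and hlt1)
  rw [Set.mem_Ioi] at hε₀
  set C : ℝ := ((jEps lam ε₀ ^ dEps γ ε₀ : ℕ) : ℝ) with hC
  have hε₀1 : ε₀ < 1 := (hsm ⟨hε₀, le_rfl⟩).2
  have hj1 : 1 ≤ jEps lam ε₀ := le_jEps hl hε₀ le_rfl
    (by rw [hlam1]; exact pow_lt_one₀ hε₀.le hε₀1 two_ne_zero)
  have hC1 : 1 ≤ C := by
    rw [hC]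
    exact_mod_cast Nat.one_le_pow _ _ hj1
  refine ⟨C, by linarith, fun d hd ε hε hε1 => ?_⟩
  have hreal : ∀ N : ℕ, infoN γ lam ε d ≤ (N : ℕ∞) → ∀ r : ℝ, (N : ℝ) ≤ r →
      (infoN γ lam ε d : ℝ≥0∞) ≤ ENNReal.ofReal r := by
    intro N hN r hr
    have h1 : (infoN γ lam ε d : ℝ≥0∞) ≤ ((N : ℕ∞) : ℝ≥0∞) := by exact_mod_cast hN
    rw [ENat.toENNReal_coe, ← ENNReal.ofReal_natCast] at h1
    exact h1.trans (ENNReal.ofReal_le_ofReal hr)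
  rcases le_or_gt ε ε₀ with hle | hgt
  · obtain ⟨h1, h2⟩ := hsm ⟨hε, hle⟩
    refine hreal _ (infoN_le_pow hlam1 hlam_anti hlam_nonneg hγ_pos hγ_le hl hg hε h2 d) _
      ((h1 d hd).trans ?_)
    exact le_mul_of_one_le_left (Real.exp_pos _).le hC1
  · refine hreal _ ((infoN_anti γ lam hε₀.le hgt.le d).trans
      (infoN_le_pow hlam1 hlam_anti hlam_nonneg hγ_pos hγ_le hl hg hε₀ hε₀1 d)) _ ?_
    have h1 : ((jEps lam ε₀ ^ min d (dEps γ ε₀) : ℕ) : ℝ) ≤ C := by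
      rw [hC]
      exact_mod_cast Nat.pow_le_pow_right hj1 (min_le_right _ _)
    refine h1.trans (le_mul_of_one_le_right (by linarith) (Real.one_le_exp ?_))
    have hlogd := Real.log_natCast_nonneg d
    have hlogε : 0 ≤ Real.log ε⁻¹ := Real.log_nonneg ((one_le_inv₀ hε).2 hε1)
    have : 0 ≤ Real.log (1 + Real.log ε⁻¹) := Real.log_nonneg (by linarith)
    positivity

/-- EXP-QPT holds iff λ_j → 0, γ_j → 0 and
B = limsup_{ε→0⁺} d(ε)·log j(ε) / ((log d(ε))·log log ε⁻¹) < ∞; in that case the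
exponent t* of EXP-QPT equals B. -/
theorem stmt2 (γ lam : ℕ → ℝ)
    (hlam_anti : AntitoneOn lam (Set.Ici 1)) (hlam1 : lam 1 = 1) (hlam2 : 0 < lam 2)
    (hlam_nonneg : ∀ j, 1 ≤ j → 0 ≤ lam j)
    (hγ_anti : AntitoneOn γ (Set.Ici 1))
    (hγ_pos : ∀ j, 1 ≤ j → 0 < γ j) (hγ_le : ∀ j, 1 ≤ j → γ j ≤ 1) :
    (ExpQPT γ lam ↔
      (Tendsto lam atTop (nhds 0) ∧ Tendsto γ atTop (nhds 0) ∧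
        Filter.IsBoundedUnder (· ≤ ·) (nhdsWithin (0:ℝ) (Set.Ioi 0))
          (fun ε => (dEps γ ε : ℝ) * Real.log (jEps lam ε) /
            (Real.log (dEps γ ε) * Real.log (Real.log ε⁻¹))))) ∧
    ((Tendsto lam atTop (nhds 0) ∧ Tendsto γ atTop (nhds 0) ∧
        Filter.IsBoundedUnder (· ≤ ·) (nhdsWithin (0:ℝ) (Set.Ioi 0))
          (fun ε => (dEps γ ε : ℝ) * Real.log (jEps lam ε) /
            (Real.log (dEps γ ε) * Real.log (Real.log ε⁻¹)))) →
      sInf {t : ℝ | 0 ≤ t ∧ ExpQPTwith γ lam t} =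
        Filter.limsup
          (fun ε => (dEps γ ε : ℝ) * Real.log (jEps lam ε) /
            (Real.log (dEps γ ε) * Real.log (Real.log ε⁻¹)))
          (nhdsWithin (0:ℝ) (Set.Ioi 0))) := by
  have hsuff : ∀ s : ℝ, Tendsto lam atTop (nhds 0) → Tendsto γ atTop (nhds 0) →
      (∀ᶠ ε in nhdsWithin (0 : ℝ) (Set.Ioi 0), (dEps γ ε : ℝ) * Real.log (jEps lam ε) /
        (Real.log (dEps γ ε) * Real.log (Real.log ε⁻¹)) ≤ s) →
      0 ≤ s ∧ ExpQPTwith γ lam s := by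
    intro s hl hg h
    obtain ⟨ε, h1, h2⟩ := (h.and (eventually_nonneg_ratio (lam := lam) hγ_pos hg)).exists
    have hs : 0 ≤ s := h2.trans h1
    exact ⟨hs, expQPTwith_of_eventually_le hlam1 hlam_anti hlam_nonneg hγ_pos hγ_le hl hg hs h⟩
  refine ⟨⟨?_, ?_⟩, ?_⟩
  · rintro ⟨t, ht, h⟩
    have hl := h.tendsto_lam hlam_anti hlam_nonneg hγ_pos
    have hg := h.tendsto_gamma ht hlam2 hγ_anti hγ_pos
    exact ⟨hl, hg, t + 1, eventually_map.2
      (h.eventually_le ht hlam_anti hlam2 hγ_anti hγ_pos hl hg (lt_add_one t))⟩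
  · rintro ⟨hl, hg, s, hs⟩
    exact ⟨s, hsuff s hl hg (eventually_map.1 hs)⟩
  · rintro ⟨hl, hg, hbdd⟩
    have hcob : Filter.IsCoboundedUnder (· ≤ ·) (nhdsWithin (0:ℝ) (Set.Ioi 0))
        (fun ε => (dEps γ ε : ℝ) * Real.log (jEps lam ε) /
          (Real.log (dEps γ ε) * Real.log (Real.log ε⁻¹))) :=
      Filter.IsBoundedUnder.isCoboundedUnder_le
        ⟨0, eventually_map.2 (eventually_nonneg_ratio (lam := lam) hγ_pos hg)⟩
    have hbelow : BddBelow {t : ℝ | 0 ≤ t ∧ ExpQPTwith γ lam t} := ⟨0, fun t ht => ht.1⟩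
    apply le_antisymm
    · refine le_of_forall_gt_imp_ge_of_dense fun s hs => ?_
      refine csInf_le hbelow (hsuff s hl hg ?_)
      exact (eventually_lt_of_limsup_lt hs hbdd).mono fun _ h => h.le
    · obtain ⟨s, hs⟩ := hbdd
      refine le_csInf ⟨s, hsuff s hl hg (eventually_map.1 hs)⟩ fun t ht => ?_
      refine le_of_forall_gt_imp_ge_of_dense fun s hs => ?_
      exact limsup_le_of_le hcob
        (ht.2.eventually_le ht.1 hlam_anti hlam2 hγ_anti hγ_pos hl hg hs)
end
end

section
/- Let s > 1, 0 < t ≤ 1, and assume λ_2 < 1. Then EXP-(s,t)-WT holds if and only if lim_{j→∞} (log λ_j⁻¹)^s / log j = ∞, i.e., for every M > 0 one has (log λ_j⁻¹)^s > M·log j for all sufficiently large j (understood to hold at j whenever λ_j = 0); no condition on the weights γ_j is needed. -/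
open Filter Real Set Topology
open scoped ENNReal NNReal

noncomputable section

/-- A summable family of weights on the natural numbers whose total mass is at most
`1 + (∑ j⁻²) / d`. -/
def tupleWeight (d j : ℕ) : ℝ := if j = 1 then 1 else ((d : ℝ) * (j : ℝ) ^ 2)⁻¹

theorem tupleWeight_nonneg (d j : ℕ) : 0 ≤ tupleWeight d j := by
  unfold tupleWeight
  split_ifs <;> positivity

theorem sum_tupleWeight_le (d : ℕ) (F : Finset ℕ) :
    ∑ j ∈ F, tupleWeight d j ≤ 1 + (∑' j : ℕ, ((j : ℝ) ^ 2)⁻¹) / d := by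
  have hsum : Summable fun j : ℕ => ((j : ℝ) ^ 2)⁻¹ := Real.summable_nat_pow_inv.2 (by norm_num)
  calc ∑ j ∈ F, tupleWeight d j
      ≤ ∑ j ∈ F, ((if j = 1 then 1 else 0) + ((j : ℝ) ^ 2)⁻¹ / d) := by
        refine Finset.sum_le_sum fun j _ => ?_
        unfold tupleWeight
        split_ifs
        · have : 0 ≤ ((j : ℝ) ^ 2)⁻¹ / d := by positivity
          linarith
        · rw [mul_inv, zero_add, div_eq_mul_inv, mul_comm]
    _ = (∑ j ∈ F, if j = 1 then (1 : ℝ) else 0) + (∑ j ∈ F, ((j : ℝ) ^ 2)⁻¹) / d := by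
        rw [Finset.sum_add_distrib, Finset.sum_div]
    _ ≤ 1 + (∑' j : ℕ, ((j : ℝ) ^ 2)⁻¹) / d := by
        gcongr
        · rw [Finset.sum_ite_eq']
          split_ifs <;> norm_num
        · exact hsum.sum_le_tsum F fun j _ => by positivity

/-- A set of tuples on which the product weight is at least `exp (-B)` has at most
`exp (B + ∑ j⁻²)` elements. -/
theorem encard_le_of_tupleWeight {d : ℕ} (hd : 1 ≤ d) (B : ℝ) (A : Set (Fin d → ℕ))
    (hA : ∀ n ∈ A, Real.exp (-B) ≤ ∏ i, tupleWeight d (n i)) :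
    ∃ N : ℕ, A.encard = (N : ℕ∞) ∧ (N : ℝ) ≤ Real.exp (B + ∑' j : ℕ, ((j : ℝ) ^ 2)⁻¹) := by
  set S : ℝ := ∑' j : ℕ, ((j : ℝ) ^ 2)⁻¹ with hS
  have hS0 : 0 ≤ S := tsum_nonneg fun j => by positivity
  have hd0 : (0 : ℝ) < d := by exact_mod_cast hd
  have key : ∀ F : Finset (Fin d → ℕ), (F : Set (Fin d → ℕ)) ⊆ A →
      (F.card : ℝ) ≤ Real.exp (B + S) := by
    intro F hF
    let K : Finset ℕ := F.biUnion fun n => Finset.univ.image n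
    have hFK : F ⊆ Fintype.piFinset fun _ : Fin d => K := by
      intro n hn
      rw [Fintype.mem_piFinset]
      intro i
      exact Finset.mem_biUnion.2 ⟨n, hn, Finset.mem_image_of_mem _ (Finset.mem_univ i)⟩
    have h1 : (F.card : ℝ) * Real.exp (-B) ≤ Real.exp S := by
      calc (F.card : ℝ) * Real.exp (-B) = ∑ _n ∈ F, Real.exp (-B) := by simp
        _ ≤ ∑ n ∈ F, ∏ i, tupleWeight d (n i) :=
            Finset.sum_le_sum fun n hn => hA n (hF hn)
        _ ≤ ∑ n ∈ Fintype.piFinset fun _ : Fin d => K, ∏ i, tupleWeight d (n i) :=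
            Finset.sum_le_sum_of_subset_of_nonneg hFK fun n _ _ =>
              Finset.prod_nonneg fun i _ => tupleWeight_nonneg d _
        _ = ∏ _i : Fin d, ∑ j ∈ K, tupleWeight d j :=
            (Finset.prod_univ_sum (fun _ : Fin d => K) fun _ j => tupleWeight d j).symm
        _ = (∑ j ∈ K, tupleWeight d j) ^ d := by simp
        _ ≤ (Real.exp (S / d)) ^ d := by
            refine pow_le_pow_left₀ (Finset.sum_nonneg fun j _ => tupleWeight_nonneg d j) ?_ d
            have := sum_tupleWeight_le d K
            have := Real.add_one_le_exp (S / d)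
            linarith
        _ = Real.exp S := by
            rw [← Real.exp_nat_mul]
            congr 1
            field_simp
    calc (F.card : ℝ) = (F.card : ℝ) * Real.exp (-B) * Real.exp B := by
          rw [mul_assoc, ← Real.exp_add]; simp
      _ ≤ Real.exp S * Real.exp B := by gcongr
      _ = Real.exp (B + S) := by rw [← Real.exp_add, add_comm]
  have hfin : A.Finite := by
    by_contra hinf
    obtain ⟨m, hm⟩ := exists_nat_gt (Real.exp (B + S))
    obtain ⟨F, hFA, hFc⟩ := Set.Infinite.exists_subset_card_eq hinf m
    have := key F hFA
    rw [hFc] at this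
    linarith
  refine ⟨hfin.toFinset.card, hfin.encard_eq_coe_toFinset_card, key _ (by simp)⟩

theorem exp_neg_le_tupleWeight {γ lam : ℕ → ℝ} {s δ C L : ℝ} {d k j : ℕ}
    (hs : 1 < s) (hδ : 0 ≤ δ) (hC : 0 ≤ C) (hd : 1 ≤ d) (hj : 1 ≤ j)
    (hγ_pos : 0 < γ k) (hγ_le : γ k ≤ 1) (hlam2lt : lam 2 < 1)
    (hlam_anti : AntitoneOn lam (Set.Ici 1))
    (hlog : 0 < lam j → Real.log j ≤ δ * Real.log ((lam j)⁻¹) ^ s + C)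
    (hpos : 0 < lamKJ γ lam k j) (hL : Real.log ((lamKJ γ lam k j)⁻¹) ≤ L) :
    Real.exp (-(((Real.log d + 2 * C) / Real.log ((lam 2)⁻¹) + 2 * δ * L ^ (s - 1)) *
      Real.log ((lamKJ γ lam k j)⁻¹))) ≤ tupleWeight d j := by
  by_cases h1 : j = 1
  · simp [lamKJ, tupleWeight, h1]
  have hj2 : 2 ≤ j := by omega
  have hd0 : (0 : ℝ) < d := by exact_mod_cast hd
  have hj0 : (0 : ℝ) < j := by exact_mod_cast hj
  have hw : tupleWeight d j = Real.exp (-(Real.log d + 2 * Real.log j)) := by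
    rw [tupleWeight, if_neg h1, Real.exp_neg, Real.exp_add, Real.exp_log hd0,
      two_mul, Real.exp_add, Real.exp_log hj0, sq]
  have hμ : lamKJ γ lam k j = γ k * lam j := by simp [lamKJ, h1]
  rw [hμ] at hpos hL ⊢
  rw [hw, Real.exp_le_exp, neg_le_neg_iff]
  have hlj : 0 < lam j := by
    by_contra h
    exact absurd hpos (not_lt.2 (mul_nonpos_of_nonneg_of_nonpos hγ_pos.le (not_lt.1 h)))
  have hle2 : lam j ≤ lam 2 := hlam_anti (by simp) (by simpa using hj) hj2
  have hl2 : 0 < lam 2 := hlj.trans_le hle2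
  set a := Real.log ((lam 2)⁻¹) with ha
  set x := Real.log ((γ k * lam j)⁻¹) with hx
  have ha0 : 0 < a := Real.log_pos ((one_lt_inv₀ hl2).2 hlam2lt)
  have hax : a ≤ Real.log ((lam j)⁻¹) :=
    Real.log_le_log (by positivity) (inv_anti₀ hlj hle2)
  have hxx : Real.log ((lam j)⁻¹) ≤ x :=
    Real.log_le_log (by positivity) (inv_anti₀ hpos (mul_le_of_le_one_left hlj.le hγ_le))
  have hx0 : 0 < x := by linarith
  have hpow : Real.log ((lam j)⁻¹) ^ s ≤ L ^ (s - 1) * x := by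
    calc Real.log ((lam j)⁻¹) ^ s ≤ x ^ s :=
          Real.rpow_le_rpow (by linarith) hxx (by linarith)
      _ = x ^ (s - 1) * x := by
          rw [← Real.rpow_add_one hx0.ne', sub_add_cancel]
      _ ≤ L ^ (s - 1) * x := by
          gcongr
  have hlogd : 0 ≤ Real.log d := Real.log_nonneg (by exact_mod_cast hd)
  have h2 : Real.log d + 2 * C ≤ (Real.log d + 2 * C) / a * x := by
    rw [div_mul_eq_mul_div, le_div_iff₀ ha0]
    exact mul_le_mul_of_nonneg_left (by linarith) (by linarith)
  have h3 := hlog hlj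
  have h4 := mul_le_mul_of_nonneg_left hpow hδ
  nlinarith

theorem lamKJ_le_one {γ lam : ℕ → ℝ} {k j : ℕ} (hlam_anti : AntitoneOn lam (Set.Ici 1))
    (hlam1 : lam 1 = 1) (hγ_pos : 0 < γ k) (hγ_le : γ k ≤ 1) (hj : 1 ≤ j) :
    lamKJ γ lam k j ≤ 1 := by
  unfold lamKJ
  split_ifs with h
  · exact le_rfl
  · have : lam j ≤ 1 := hlam1 ▸ hlam_anti (by simp) (by simpa using hj) hj
    nlinarith

theorem lamKJ_nonneg {γ lam : ℕ → ℝ} {k j : ℕ} (hlam_nonneg : ∀ j, 1 ≤ j → 0 ≤ lam j)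
    (hγ_pos : 0 < γ k) (hj : 1 ≤ j) : 0 ≤ lamKJ γ lam k j := by
  unfold lamKJ
  split_ifs with h
  · exact zero_le_one
  · exact mul_nonneg hγ_pos.le (hlam_nonneg j hj)

/-- If `log j ≤ δ (log λ_j⁻¹)^s + C` whenever `λ_j > 0`, then `n(ε,d)` is finite and
`log n(ε,d)` grows at most like `2 δ L^s + O(L (1 + log d))` with `L = log ε⁻²`. -/
theorem infoN_le_exp {γ lam : ℕ → ℝ} {s δ C ε : ℝ} {d : ℕ}
    (hlam_anti : AntitoneOn lam (Set.Ici 1)) (hlam1 : lam 1 = 1)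
    (hlam_nonneg : ∀ j, 1 ≤ j → 0 ≤ lam j)
    (hγ_pos : ∀ j, 1 ≤ j → 0 < γ j) (hγ_le : ∀ j, 1 ≤ j → γ j ≤ 1)
    (hs : 1 < s) (hlam2 : 0 < lam 2) (hlam2lt : lam 2 < 1) (hδ : 0 ≤ δ) (hC : 0 ≤ C) (hd : 1 ≤ d)
    (hε0 : 0 < ε) (hε1 : ε ≤ 1)
    (hlog : ∀ j : ℕ, 1 ≤ j → 0 < lam j → Real.log j ≤ δ * Real.log ((lam j)⁻¹) ^ s + C) :
    ∃ N : ℕ, infoN γ lam ε d = (N : ℕ∞) ∧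
      (N : ℝ) ≤ Real.exp (((Real.log d + 2 * C) / Real.log ((lam 2)⁻¹) +
        2 * δ * (2 * Real.log ε⁻¹) ^ (s - 1)) * (2 * Real.log ε⁻¹) +
          ∑' j : ℕ, ((j : ℝ) ^ 2)⁻¹) := by
  refine encard_le_of_tupleWeight hd _ _ ?_
  rintro n ⟨hn1, hn⟩
  set L := 2 * Real.log ε⁻¹ with hL
  set V := (Real.log d + 2 * C) / Real.log ((lam 2)⁻¹) + 2 * δ * L ^ (s - 1) with hV
  set μ : Fin d → ℝ := fun i => lamKJ γ lam (i.1 + 1) (n i) with hμ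
  have hμ1 : ∀ i, μ i ≤ 1 := fun i =>
    lamKJ_le_one hlam_anti hlam1 (hγ_pos _ (by omega)) (hγ_le _ (by omega)) (hn1 i)
  have hμ0 : ∀ i, 0 ≤ μ i := fun i =>
    lamKJ_nonneg hlam_nonneg (hγ_pos _ (by omega)) (hn1 i)
  have hprod : 0 < ∏ i, μ i := lt_of_le_of_lt (sq_nonneg ε) hn
  have hμpos : ∀ i, 0 < μ i := fun i =>
    lt_of_le_of_ne (hμ0 i) fun h => hprod.ne' (Finset.prod_eq_zero (Finset.mem_univ i) h.symm)
  have hlog0 : ∀ i, 0 ≤ Real.log ((μ i)⁻¹) := fun i =>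
    Real.log_nonneg ((one_le_inv₀ (hμpos i)).2 (hμ1 i))
  have hsum : ∑ i, Real.log ((μ i)⁻¹) ≤ L := by
    have h1 : ∑ i, Real.log ((μ i)⁻¹) = -Real.log (∏ i, μ i) := by
      rw [Real.log_prod fun i _ => (hμpos i).ne', ← Finset.sum_neg_distrib]
      exact Finset.sum_congr rfl fun i _ => Real.log_inv _
    have h2 : Real.log (ε ^ 2) ≤ Real.log (∏ i, μ i) := Real.log_le_log (by positivity) hn.le
    rw [Real.log_pow] at h2
    rw [h1, hL, Real.log_inv]
    push_cast at h2
    linarith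
  have hle : ∀ i, Real.log ((μ i)⁻¹) ≤ L := fun i =>
    (Finset.single_le_sum (fun i _ => hlog0 i) (Finset.mem_univ i)).trans hsum
  have hL0 : 0 ≤ L := mul_nonneg zero_le_two (Real.log_nonneg ((one_le_inv₀ hε0).2 hε1))
  have hV0 : 0 ≤ V := by
    have h1 : 0 ≤ Real.log d := Real.log_nonneg (by exact_mod_cast hd)
    have h2 : 0 < Real.log ((lam 2)⁻¹) := Real.log_pos ((one_lt_inv₀ hlam2).2 hlam2lt)
    positivity
  calc Real.exp (-(V * L)) ≤ Real.exp (∑ i, -(V * Real.log ((μ i)⁻¹))) := by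
        rw [Real.exp_le_exp, Finset.sum_neg_distrib, ← Finset.mul_sum]
        exact neg_le_neg (mul_le_mul_of_nonneg_left hsum hV0)
    _ = ∏ i, Real.exp (-(V * Real.log ((μ i)⁻¹))) := Real.exp_sum _ _
    _ ≤ ∏ i, tupleWeight d (n i) :=
        Finset.prod_le_prod (fun i _ => (Real.exp_pos _).le) fun i _ =>
          exp_neg_le_tupleWeight hs hδ hC hd (hn1 i) (hγ_pos _ (by omega)) (hγ_le _ (by omega))
            hlam2lt hlam_anti (hlog _ (hn1 i)) (hμpos i) (hle i)

theorem natCast_le_infoN_one {γ lam : ℕ → ℝ} {ε : ℝ} {j : ℕ}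
    (hlam_anti : AntitoneOn lam (Set.Ici 1)) (hγ_pos : 0 < γ 1)
    (hε0 : 0 < ε) (hε1 : ε < 1) (hε : ε ^ 2 < γ 1 * lam j) :
    (j : ℕ∞) ≤ infoN γ lam ε 1 := by
  have hsub : (fun m : ℕ => fun _ : Fin 1 => m) '' (Set.Icc 1 j) ⊆
      {n : Fin 1 → ℕ | (∀ i, 1 ≤ n i) ∧ ε ^ 2 < ∏ i, lamKJ γ lam (i.1 + 1) (n i)} := by
    rintro _ ⟨m, ⟨hm1, hmj⟩, rfl⟩
    refine ⟨fun _ => hm1, ?_⟩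
    simp only [Finset.univ_unique, Finset.prod_singleton, lamKJ]
    split_ifs with h
    · nlinarith
    · have hle : lam j ≤ lam m := hlam_anti (by simpa using hm1) (by simpa using hm1.trans hmj) hmj
      simpa using hε.trans_le (mul_le_mul_of_nonneg_left hle hγ_pos.le)
  refine le_trans ?_ (Set.encard_le_encard hsub)
  rw [Function.Injective.encard_image fun a b h => congrFun h 0]
  rw [← Finset.coe_Icc, Set.encard_coe_eq_coe_finsetCard]
  simp

/-- For `s > 1` and `t > 0` the product
`y (C₁ + C₂ log d)` is negligible against `d ^ t + y ^ s`. -/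
theorem exists_mul_log_le {s t : ℝ} (hs : 1 < s) (ht : 0 < t) {C₁ C₂ η : ℝ}
    (hC₁ : 0 ≤ C₁) (hC₂ : 0 ≤ C₂) (hη : 0 < η) :
    ∃ R : ℝ, ∀ d : ℕ, 1 ≤ d → ∀ y : ℝ, 1 ≤ y →
      y * (C₁ + C₂ * Real.log d) ≤ η * ((d : ℝ) ^ t + y ^ s) + R := by
  have hs1 : 0 < s - 1 := by linarith
  set p := (s - 1)⁻¹ with hp
  have hp0 : 0 < p := inv_pos.2 hs1
  set v : ℝ → ℝ := fun z => C₁ + C₂ * Real.log z with hv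
  set h : ℝ → ℝ := fun z => (v z / η) ^ p * v z with hh
  have hlog1 : v =O[atTop] Real.log :=
    Real.isLittleO_const_log_atTop.isBigO.add
      (Asymptotics.isBigO_const_mul_self C₂ Real.log atTop)
  have hev : ∀ᶠ z : ℝ in atTop, 0 ≤ Real.log z :=
    (eventually_ge_atTop 1).mono fun z hz => Real.log_nonneg hz
  have hO : h =O[atTop] fun z : ℝ => Real.log z ^ (p + 1) := by
    have h1 : (fun z => (v z / η) ^ p) =O[atTop] fun z : ℝ => Real.log z ^ p := by
      refine Asymptotics.IsBigO.rpow hp0.le hev ?_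
      simp only [div_eq_inv_mul]
      exact hlog1.const_mul_left _
    refine (h1.mul hlog1).congr' EventuallyEq.rfl ?_
    filter_upwards [eventually_gt_atTop 1] with z hz
    rw [Real.rpow_add_one (Real.log_pos hz).ne']
  have ho : h =o[atTop] fun z : ℝ => z ^ t :=
    hO.trans_isLittleO (isLittleO_log_rpow_rpow_atTop (p + 1) ht)
  have hbd : ∀ᶠ d : ℕ in atTop, h d ≤ η * (d : ℝ) ^ t := by
    filter_upwards [tendsto_natCast_atTop_atTop.eventually (ho.bound hη)] with d hd
    have h2 : 0 ≤ (d : ℝ) ^ t := by positivity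
    rw [Real.norm_of_nonneg h2] at hd
    exact (le_abs_self _).trans hd
  obtain ⟨D, hD⟩ := eventually_atTop.1 hbd
  refine ⟨∑ d ∈ Finset.range D, |h d|, fun d hd y hy => ?_⟩
  have hR : h d ≤ η * (d : ℝ) ^ t + ∑ d ∈ Finset.range D, |h d| := by
    by_cases hdD : D ≤ d
    · have := hD d hdD
      have : 0 ≤ ∑ d ∈ Finset.range D, |h d| := Finset.sum_nonneg fun _ _ => abs_nonneg _
      linarith
    · have h1 : |h d| ≤ ∑ d ∈ Finset.range D, |h d| :=
        Finset.single_le_sum (f := fun d : ℕ => |h d|) (fun _ _ => abs_nonneg _)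
          (Finset.mem_range.2 (not_le.1 hdD))
      have h2 : 0 ≤ η * (d : ℝ) ^ t := by positivity
      linarith [le_abs_self (h d)]
  have hlogd : 0 ≤ Real.log d := Real.log_nonneg (by exact_mod_cast hd)
  have hv0 : 0 ≤ v d := by simp only [hv]; positivity
  have hy0 : 0 < y := by linarith
  have hys : y ^ s = y ^ (s - 1) * y := by rw [← Real.rpow_add_one hy0.ne', sub_add_cancel]
  have hmain : y * v d ≤ η * y ^ s + h d := by
    rcases le_total (v d / η) (y ^ (s - 1)) with hc | hc
    · have h0 : 0 ≤ h d := by simp only [hh]; positivity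
      rw [div_le_iff₀ hη] at hc
      rw [hys]
      nlinarith
    · have h1 : y ≤ (v d / η) ^ p := by
        have := Real.rpow_le_rpow (by positivity) hc hp0.le
        rwa [← Real.rpow_mul hy0.le, hp, mul_inv_cancel₀ hs1.ne', Real.rpow_one] at this
      have h2 : y * v d ≤ h d := mul_le_mul_of_nonneg_right h1 hv0
      have h3 : 0 ≤ η * y ^ s := by positivity
      linarith
  have : y * (C₁ + C₂ * Real.log d) = y * v d := rfl
  linarith

/-- The normalisation `d ^ t + (1 + log ε⁻¹) ^ s` tends to infinity as `d + ε⁻¹ → ∞`. -/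
theorem exists_forall_le_rpow_add_rpow {s t : ℝ} (hs : 1 < s) (ht : 0 < t) (M : ℝ) :
    ∃ T : ℝ, ∀ d : ℕ, ∀ ε : ℝ, 0 < ε → ε ≤ 1 → T ≤ (d : ℝ) + ε⁻¹ →
      M ≤ (d : ℝ) ^ t + (1 + Real.log ε⁻¹) ^ s := by
  refine ⟨|M| ^ t⁻¹ + Real.exp |M|, fun d ε hε0 hε1 hT => ?_⟩
  have hlog : 0 ≤ Real.log ε⁻¹ := Real.log_nonneg ((one_le_inv₀ hε0).2 hε1)
  have hd0 : 0 ≤ (d : ℝ) ^ t := by positivity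
  have hy0 : 0 ≤ (1 + Real.log ε⁻¹) ^ s := by positivity
  refine (le_abs_self M).trans ?_
  by_cases h : |M| ^ t⁻¹ ≤ (d : ℝ)
  · have := Real.rpow_le_rpow (by positivity) h ht.le
    rw [← Real.rpow_mul (abs_nonneg M), inv_mul_cancel₀ ht.ne', Real.rpow_one] at this
    linarith
  · have h1 : Real.exp |M| ≤ ε⁻¹ := by linarith [not_le.1 h]
    have h2 : |M| ≤ Real.log ε⁻¹ := (Real.le_log_iff_exp_le (by positivity)).2 h1
    have h3 := Real.rpow_le_rpow_of_exponent_le (x := 1 + Real.log ε⁻¹) (by linarith) hs.le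
    rw [Real.rpow_one] at h3
    linarith

theorem eventually_lt_of_expSTWT {γ lam : ℕ → ℝ} {s t : ℝ}
    (hlam_anti : AntitoneOn lam (Set.Ici 1)) (hγ_pos : 0 < γ 1)
    (h : ExpSTWT γ lam s t) {η : ℝ} (hη : 0 < η) : ∀ᶠ j : ℕ in atTop, lam j < η := by
  have hex : ∃ j, 1 ≤ j ∧ lam j < η := by
    by_contra! hcon
    obtain ⟨T, hT⟩ := h 1 one_pos
    have hlim : Tendsto (fun ε : ℝ => ε ^ 2) (𝓝[>] 0) (𝓝 0) := by
      have : Tendsto (fun ε : ℝ => ε ^ 2) (𝓝 0) (𝓝 (0 ^ 2)) := (continuous_pow 2).tendsto 0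
      rw [zero_pow two_ne_zero] at this
      exact this.mono_left nhdsWithin_le_nhds
    obtain ⟨ε, ⟨hε2, hε0, hε1⟩, hεT⟩ := (((hlim.eventually_lt_const (mul_pos hγ_pos hη)).and
      (Ioo_mem_nhdsGT one_pos)).and
      (tendsto_inv_nhdsGT_zero.eventually_ge_atTop T)).exists
    obtain ⟨N, hN, -⟩ := hT 1 le_rfl ε hε0 hε1.le (by push_cast; linarith)
    have := natCast_le_infoN_one (j := N + 1) hlam_anti hγ_pos hε0 hε1
      (hε2.trans_le (mul_le_mul_of_nonneg_left (hcon (N + 1) (by omega)) hγ_pos.le))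
    rw [hN, Nat.cast_le] at this
    omega
  obtain ⟨j₀, hj₀, hlt⟩ := hex
  filter_upwards [eventually_ge_atTop j₀] with j hj
  exact (hlam_anti (by simpa using hj₀) (by simpa using hj₀.trans hj) hj).trans_lt hlt

theorem eventually_log_lt_of_expSTWT {γ lam : ℕ → ℝ} {s t : ℝ}
    (hlam_anti : AntitoneOn lam (Set.Ici 1)) (hlam_nonneg : ∀ j, 1 ≤ j → 0 ≤ lam j)
    (hγ_pos : 0 < γ 1) (hs : 0 < s) (h : ExpSTWT γ lam s t) {M : ℝ} (hM : 0 < M) :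
    ∀ᶠ j : ℕ in atTop, lam j = 0 ∨ M * Real.log j < Real.log ((lam j)⁻¹) ^ s := by
  have hc : 0 < M * (1 + 2 ^ s) := by positivity
  obtain ⟨T, hT⟩ := h _ (inv_pos.2 hc)
  have hT0 : 0 < |T| + 1 := by positivity
  filter_upwards [eventually_ge_atTop 1, eventually_lt_of_expSTWT hlam_anti hγ_pos h hγ_pos,
    eventually_lt_of_expSTWT hlam_anti hγ_pos h (Real.exp_pos (-1)),
    eventually_lt_of_expSTWT hlam_anti hγ_pos h (inv_pos.2 hT0)] with j hj1 hjγ hje hjT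
  rcases (hlam_nonneg j hj1).eq_or_lt with h0 | h0
  · exact Or.inl h0.symm
  right
  have hx1 : 1 ≤ Real.log ((lam j)⁻¹) := by
    rw [Real.log_inv]
    have := (Real.log_lt_iff_lt_exp h0).2 hje
    linarith
  have hlt1 : lam j < 1 := hje.trans (Real.exp_lt_one_iff.2 (by norm_num))
  have hinv : |T| + 1 < (lam j)⁻¹ := (lt_inv_comm₀ hT0 h0).2 hjT
  obtain ⟨N, hN, hNlt⟩ := hT 1 le_rfl (lam j) h0 hlt1.le (by
    push_cast
    linarith [le_abs_self T])
  have hjN : j ≤ N := by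
    have := natCast_le_infoN_one (j := j) hlam_anti hγ_pos h0 hlt1 (by rw [sq]; gcongr)
    rwa [hN, Nat.cast_le] at this
  set x := Real.log ((lam j)⁻¹) with hx
  have hj0 : (0 : ℝ) < j := by exact_mod_cast hj1
  have hlogj : Real.log j ≤ Real.log (max 1 (N : ℝ)) :=
    Real.log_le_log hj0 ((Nat.cast_le.2 hjN).trans (le_max_right _ _))
  have hxs : 1 ≤ x ^ s := Real.one_le_rpow hx1 hs.le
  have h1x : (1 + x) ^ s ≤ 2 ^ s * x ^ s := by
    rw [← Real.mul_rpow zero_le_two (by linarith)]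
    exact Real.rpow_le_rpow (by linarith) (by linarith) hs.le
  have hden : 0 < (1 : ℝ) + (1 + x) ^ s := by positivity
  rw [Nat.cast_one, Real.one_rpow, div_lt_iff₀ hden, inv_mul_eq_div, lt_div_iff₀ hc] at hNlt
  have h2 : Real.log j * (M * (1 + 2 ^ s)) < (1 + 2 ^ s) * x ^ s := by
    calc Real.log j * (M * (1 + 2 ^ s)) ≤ Real.log (max 1 (N : ℝ)) * (M * (1 + 2 ^ s)) := by gcongr
      _ < 1 + (1 + x) ^ s := hNlt
      _ ≤ (1 + 2 ^ s) * x ^ s := by linarith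
  have h3 : (0 : ℝ) < 1 + 2 ^ s := by positivity
  refine lt_of_mul_lt_mul_left ?_ h3.le
  linarith

theorem exists_log_le_of_eventually {lam : ℕ → ℝ} {s : ℝ}
    (hlam_le : ∀ j, 1 ≤ j → lam j ≤ 1)
    (h : ∀ M : ℝ, 0 < M → ∀ᶠ j : ℕ in atTop,
      lam j = 0 ∨ M * Real.log j < Real.log ((lam j)⁻¹) ^ s) {δ : ℝ} (hδ : 0 < δ) :
    ∃ C : ℝ, 0 ≤ C ∧ ∀ j : ℕ, 1 ≤ j → 0 < lam j →
      Real.log j ≤ δ * Real.log ((lam j)⁻¹) ^ s + C := by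
  obtain ⟨J, hJ⟩ := eventually_atTop.1 (h δ⁻¹ (inv_pos.2 hδ))
  refine ⟨Real.log (J + 1), Real.log_nonneg (by simp), fun j hj hpos => ?_⟩
  have hC : 0 ≤ Real.log ((J : ℝ) + 1) := Real.log_nonneg (by simp)
  by_cases hjJ : J ≤ j
  · rcases hJ j hjJ with h0 | h0
    · exact absurd h0 hpos.ne'
    · rw [inv_mul_eq_div, div_lt_iff₀ hδ] at h0
      linarith
  · have h1 : Real.log j ≤ Real.log ((J : ℝ) + 1) := by
      refine Real.log_le_log (by exact_mod_cast hj) ?_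
      exact_mod_cast (by omega : j ≤ J + 1)
    have h2 : 0 ≤ Real.log ((lam j)⁻¹) :=
      Real.log_nonneg ((one_le_inv₀ hpos).2 (hlam_le j hj))
    have : 0 ≤ δ * Real.log ((lam j)⁻¹) ^ s := by positivity
    linarith

/-- for s > 1, 0 < t ≤ 1 and λ_2 < 1, EXP-(s,t)-WT holds iff
(log λ_j⁻¹)^s / log j → ∞ (understood to hold at j whenever λ_j = 0). -/
theorem stmt6 (γ lam : ℕ → ℝ)
    (hlam_anti : AntitoneOn lam (Set.Ici 1)) (hlam1 : lam 1 = 1) (hlam2 : 0 < lam 2)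
    (hlam_nonneg : ∀ j, 1 ≤ j → 0 ≤ lam j)
    (hγ_anti : AntitoneOn γ (Set.Ici 1))
    (hγ_pos : ∀ j, 1 ≤ j → 0 < γ j) (hγ_le : ∀ j, 1 ≤ j → γ j ≤ 1)
    (s t : ℝ) (hs : 1 < s) (ht0 : 0 < t) (ht1 : t ≤ 1) (hlam2lt : lam 2 < 1) :
    ExpSTWT γ lam s t ↔
      (∀ M : ℝ, 0 < M → ∀ᶠ j : ℕ in atTop,
        lam j = 0 ∨ M * Real.log j < Real.log ((lam j)⁻¹) ^ s) := by
  constructor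
  · intro h M hM
    exact eventually_log_lt_of_expSTWT hlam_anti hlam_nonneg (hγ_pos 1 le_rfl) (by linarith) h hM
  intro h δ₀ hδ₀
  have hlam_le : ∀ j, 1 ≤ j → lam j ≤ 1 := fun j hj =>
    hlam1 ▸ hlam_anti (by simp) (by simpa using hj) hj
  set S : ℝ := ∑' j : ℕ, ((j : ℝ) ^ 2)⁻¹ with hS
  have hS0 : 0 ≤ S := tsum_nonneg fun j => by positivity
  set a := Real.log ((lam 2)⁻¹) with ha
  have ha0 : 0 < a := Real.log_pos ((one_lt_inv₀ hlam2).2 hlam2lt)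
  set δ : ℝ := δ₀ / (8 * 2 ^ s) with hδ
  have hδpos : 0 < δ := by positivity
  obtain ⟨C, hC0, hC⟩ := exists_log_le_of_eventually hlam_le h hδpos
  obtain ⟨R, hR⟩ := exists_mul_log_le (C₁ := 4 * C / a) (C₂ := 2 / a) (η := δ₀ / 4) hs ht0
    (by positivity) (by positivity) (by positivity)
  obtain ⟨T, hT⟩ := exists_forall_le_rpow_add_rpow hs ht0 ((S + |R| + 1) / (δ₀ / 4))
  refine ⟨T, fun d hd ε hε0 hε1 hTd => ?_⟩
  obtain ⟨N, hN, hNle⟩ := infoN_le_exp hlam_anti hlam1 hlam_nonneg hγ_pos hγ_le hs hlam2 hlam2lt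
    hδpos.le hC0 hd hε0 hε1 hC
  refine ⟨N, hN, ?_⟩
  have hl0 : 0 ≤ Real.log ε⁻¹ := Real.log_nonneg ((one_le_inv₀ hε0).2 hε1)
  have hlogd : 0 ≤ Real.log d := Real.log_nonneg (by exact_mod_cast hd)
  have hTd' := hT d ε hε0 hε1 hTd
  rw [div_le_iff₀ (by positivity)] at hTd'
  have hRd := hR d hd (1 + Real.log ε⁻¹) (by linarith)
  set l := Real.log ε⁻¹ with hl
  have hd0 : (0 : ℝ) < d := by exact_mod_cast hd
  have hden : 0 < (d : ℝ) ^ t + (1 + l) ^ s := by positivity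
  have hpow : (2 * l) ^ (s - 1) * (2 * l) ≤ 2 ^ s * (1 + l) ^ s := by
    have h1 : (2 * l) ^ (s - 1) ≤ (2 * (1 + l)) ^ (s - 1) :=
      Real.rpow_le_rpow (by positivity) (by linarith) (by linarith)
    calc (2 * l) ^ (s - 1) * (2 * l) ≤ (2 * (1 + l)) ^ (s - 1) * (2 * (1 + l)) := by
          gcongr
          linarith
      _ = (2 * (1 + l)) ^ s := by
          rw [← Real.rpow_add_one (by positivity), sub_add_cancel]
      _ = 2 ^ s * (1 + l) ^ s := Real.mul_rpow zero_le_two (by linarith)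
  have hE : ((Real.log d + 2 * C) / a + 2 * δ * (2 * l) ^ (s - 1)) * (2 * l) + S ≤
      (1 + l) * (4 * C / a + 2 / a * Real.log d) + δ₀ / 4 * (1 + l) ^ s + S := by
    have h1 : 2 * δ * ((2 * l) ^ (s - 1) * (2 * l)) ≤ δ₀ / 4 * (1 + l) ^ s := by
      calc 2 * δ * ((2 * l) ^ (s - 1) * (2 * l)) ≤ 2 * δ * (2 ^ s * (1 + l) ^ s) := by gcongr
        _ = δ₀ / 4 * (1 + l) ^ s := by
          rw [hδ]
          field_simp
          norm_num
    have h2 : (Real.log d + 2 * C) / a * (2 * l) ≤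
        (1 + l) * (4 * C / a + 2 / a * Real.log d) := by
      have h3 : (1 + l) * (4 * C / a + 2 / a * Real.log d) =
          (Real.log d + 2 * C) / a * (2 * (1 + l)) := by ring
      rw [h3]
      gcongr
      linarith
    linarith
  have hE0 : 0 ≤ ((Real.log d + 2 * C) / a + 2 * δ * (2 * l) ^ (s - 1)) * (2 * l) + S := by
    positivity
  have hlogN := Real.log_le_log (by positivity) (max_le (Real.one_le_exp hE0) hNle)
  rw [Real.log_exp] at hlogN
  rw [div_lt_iff₀ hden]
  have hdt : 0 ≤ (d : ℝ) ^ t := by positivity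
  have := mul_nonneg hδ₀.le hdt
  linarith [le_abs_self R]
end
end

section
/- Let 0 < s < 1 and t > 1, and set η = s(t−1)/(t−s). Then the following are equivalent: (i) for every non-increasing weight sequence {γ_j}_{j≥1} with 0 < γ_j ≤ 1 for all j, the problem with weights γ is EXP-(s,t)-WT; (ii) lim_{j→∞} (log λ_j⁻¹)^η / log j = ∞, i.e., for every M > 0 one has (log λ_j⁻¹)^η > M·log j for all sufficiently large j (understood to hold at j whenever λ_j = 0). -/
open Filter Real Set Topology
open scoped ENNReal NNReal

noncomputable section

/-- There are at most `2 ^ d * P ^ 2` tuples of `d` positive integers with product at most `P`. -/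
theorem exists_finset_tuples_prod_le (d : ℕ) (P : ℝ) :
    ∃ F : Finset (Fin d → ℕ), {n | (∀ i, 1 ≤ n i) ∧ ∏ i, (n i : ℝ) ≤ P} ⊆ (F : Set (Fin d → ℕ)) ∧
      (F.card : ℝ) ≤ 2 ^ d * P ^ 2 := by
  set G : Finset (Fin d → ℕ) := Fintype.piFinset fun _ => Finset.Ioo 0 (⌊P⌋₊ + 1) with hG
  refine ⟨{n ∈ G | ∏ i, (n i : ℝ) ≤ P}, ?_, ?_⟩
  · rintro n ⟨h1, hP⟩
    simp only [hG, Finset.coe_filter, Fintype.mem_piFinset, Finset.mem_Ioo, mem_ofPred_eq]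
    refine ⟨fun i => ⟨h1 i, Nat.lt_succ_of_le (Nat.le_floor ?_)⟩, hP⟩
    have h2 : n i ≤ ∏ j, n j :=
      Finset.single_le_prod' (f := n) (fun j _ => h1 j) (Finset.mem_univ i)
    refine le_trans ?_ hP
    exact_mod_cast h2
  · have hpos : ∀ n ∈ G, ∀ i, (0 : ℝ) < n i := fun n hn i => by
      have := Fintype.mem_piFinset.1 hn i
      exact_mod_cast (Finset.mem_Ioo.1 this).1
    calc (({n ∈ G | ∏ i, (n i : ℝ) ≤ P}.card : ℕ) : ℝ)
        = ∑ n ∈ G with ∏ i, (n i : ℝ) ≤ P, 1 := by simp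
      _ ≤ ∑ n ∈ G with ∏ i, (n i : ℝ) ≤ P, P ^ 2 * ∏ i, ((n i : ℝ) ^ 2)⁻¹ := by
          refine Finset.sum_le_sum fun n hn => ?_
          obtain ⟨hnG, hnP⟩ := Finset.mem_filter.1 hn
          have h0 : 0 < ∏ i, (n i : ℝ) := Finset.prod_pos fun i _ => hpos n hnG i
          rw [Finset.prod_inv_distrib, Finset.prod_pow, ← div_eq_mul_inv,
            one_le_div (by positivity)]
          gcongr
      _ ≤ ∑ n ∈ G, P ^ 2 * ∏ i, ((n i : ℝ) ^ 2)⁻¹ :=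
          Finset.sum_le_sum_of_subset_of_nonneg (Finset.filter_subset _ _)
            fun n _ _ => by positivity
      _ = P ^ 2 * ∏ _i : Fin d, ∑ j ∈ Finset.Ioo 0 (⌊P⌋₊ + 1), ((j : ℝ) ^ 2)⁻¹ := by
          rw [← Finset.mul_sum, hG, Finset.sum_prod_piFinset _ fun _ (j : ℕ) => ((j : ℝ) ^ 2)⁻¹]
      _ ≤ P ^ 2 * ∏ _i : Fin d, 2 := by
          gcongr with i
          simpa using sum_Ioo_inv_sq_le (α := ℝ) 0 (⌊P⌋₊ + 1)
      _ = 2 ^ d * P ^ 2 := by simp [mul_comm]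

/-- Jensen's inequality for `x ↦ x ^ η`, for unnormalised sums. -/
theorem sum_rpow_le_card_rpow_mul {d : ℕ} (hd : 1 ≤ d) {η x : ℝ} (hη0 : 0 ≤ η) (hη1 : η ≤ 1)
    (a : Fin d → ℝ) (ha : ∀ i, 0 ≤ a i) (hx : ∑ i, a i ≤ x) :
    ∑ i, a i ^ η ≤ (d : ℝ) ^ (1 - η) * x ^ η := by
  have hd0 : (0 : ℝ) < d := by exact_mod_cast hd
  have h := (Real.concaveOn_rpow hη0 hη1).le_map_sum (t := Finset.univ)
    (w := fun _ : Fin d => (d : ℝ)⁻¹) (p := a) (fun _ _ => by positivity)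
    (by simp [hd0.ne']) (fun i _ => ha i)
  simp only [smul_eq_mul, ← Finset.mul_sum] at h
  have hs : 0 ≤ ∑ i, a i := Finset.sum_nonneg fun i _ => ha i
  rw [Real.mul_rpow (by positivity) hs, Real.inv_rpow hd0.le] at h
  calc ∑ i, a i ^ η = d * ((d : ℝ)⁻¹ * ∑ i, a i ^ η) := by field_simp
    _ ≤ d * (((d : ℝ) ^ η)⁻¹ * (∑ i, a i) ^ η) := by gcongr
    _ = (d : ℝ) ^ (1 - η) * (∑ i, a i) ^ η := by
        rw [Real.rpow_sub hd0, Real.rpow_one]; field_simp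
    _ ≤ (d : ℝ) ^ (1 - η) * x ^ η := by gcongr

/-- The Young inequality that singles out the exponent `η = s (t - 1) / (t - s)`. -/
theorem rpow_mul_rpow_le_add_rpow {s t η : ℝ} (hs1 : s < 1) (ht : 1 < t)
    (hη : η = s * (t - 1) / (t - s)) {u v : ℝ} (hu : 0 ≤ u) (hv : 0 ≤ v) :
    u ^ (1 - η) * v ^ η ≤ u ^ t + v ^ s := by
  have hts : 0 < t - s := by linarith
  have hα : 0 ≤ (1 - s) / (t - s) := div_nonneg (by linarith) hts.le
  have hβ : 0 ≤ (t - 1) / (t - s) := div_nonneg (by linarith) hts.le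
  have hαβ : (1 - s) / (t - s) + (t - 1) / (t - s) = 1 := by field_simp; ring
  have h := Real.geom_mean_le_arith_mean2_weighted hα hβ (Real.rpow_nonneg hu t)
    (Real.rpow_nonneg hv s) hαβ
  rw [← Real.rpow_mul hu, ← Real.rpow_mul hv] at h
  have e1 : t * ((1 - s) / (t - s)) = 1 - η := by rw [hη]; field_simp; ring
  have e2 : s * ((t - 1) / (t - s)) = η := by rw [hη]; ring
  rw [e1, e2] at h
  refine h.trans (add_le_add ?_ ?_)
  · exact mul_le_of_le_one_left (Real.rpow_nonneg hu t) (by linarith)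
  · exact mul_le_of_le_one_left (Real.rpow_nonneg hv s) (by linarith)

theorem eta_pos {s t η : ℝ} (hs0 : 0 < s) (hs1 : s < 1) (ht : 1 < t)
    (hη : η = s * (t - 1) / (t - s)) : 0 < η := by
  rw [hη]
  exact div_pos (mul_pos hs0 (by linarith)) (by linarith)

theorem eta_lt_one {s t η : ℝ} (hs1 : s < 1) (ht : 1 < t)
    (hη : η = s * (t - 1) / (t - s)) : η < 1 := by
  rw [hη, div_lt_one (by linarith)]
  nlinarith

/-- A linear term in `d` is negligible against `d ^ t + (1 + log ε⁻¹) ^ s`. -/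
theorem exists_linear_lt {s t : ℝ} (hs0 : 0 < s) (ht : 1 < t) (K : ℝ) {δ : ℝ} (hδ : 0 < δ) :
    ∃ T : ℝ, ∀ d : ℕ, 1 ≤ d → ∀ ε : ℝ, 0 < ε → ε ≤ 1 → T ≤ (d : ℝ) + ε⁻¹ →
      K * d < δ * ((d : ℝ) ^ t + (1 + Real.log ε⁻¹) ^ s) := by
  obtain ⟨D, hD1, hD⟩ : ∃ D : ℝ, 1 ≤ D ∧ ∀ x ≥ D, K / δ < x ^ (t - 1) := by
    obtain ⟨D, hD⟩ := eventually_atTop.1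
      ((tendsto_rpow_atTop (by linarith : 0 < t - 1)).eventually_gt_atTop (K / δ))
    exact ⟨max 1 D, le_max_left _ _, fun x hx => hD x ((le_max_right _ _).trans hx)⟩
  have hlim : Tendsto (fun x : ℝ => (1 + Real.log x) ^ s) atTop atTop :=
    (tendsto_rpow_atTop hs0).comp (tendsto_atTop_add_const_left _ _ Real.tendsto_log_atTop)
  obtain ⟨E, hE⟩ := eventually_atTop.1 (hlim.eventually_gt_atTop (|K| * D / δ))
  refine ⟨D + E, fun d hd ε hε0 hε1 hT => ?_⟩
  have hd0 : (0 : ℝ) < d := by exact_mod_cast hd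
  have hlog : 0 ≤ Real.log ε⁻¹ := Real.log_nonneg ((one_le_inv₀ hε0).2 hε1)
  have hp1 : 0 ≤ (1 + Real.log ε⁻¹) ^ s := Real.rpow_nonneg (by linarith) s
  have hp2 : 0 < (d : ℝ) ^ t := Real.rpow_pos_of_pos hd0 t
  rcases le_total D d with h | h
  · have h1 := (div_lt_iff₀ hδ).1 (hD d h)
    rw [Real.rpow_sub hd0, Real.rpow_one, div_mul_eq_mul_div, lt_div_iff₀ hd0] at h1
    nlinarith
  · have h1 := (div_lt_iff₀ hδ).1 (hE ε⁻¹ (by linarith))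
    have h2 : K * d ≤ |K| * D := by
      gcongr
      exact le_abs_self K
    nlinarith

/-- The box `{1, …, j} ^ d` is counted as soon as `ε² < λ_j ^ d`, for constant weights `1`. -/
theorem pow_le_infoN_s9 {lam : ℕ → ℝ} (hanti : AntitoneOn lam (Set.Ici 1)) (h1 : lam 1 = 1)
    {j d : ℕ} {ε : ℝ} (hj : 0 < lam j) (hε : ε ^ 2 < lam j ^ d) :
    ((j ^ d : ℕ) : ℕ∞) ≤ infoN (fun _ => 1) lam ε d := by
  have hcard : (Fintype.piFinset fun _ : Fin d => Finset.Icc 1 j).card = j ^ d := by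
    simp
  rw [← hcard, ← Set.encard_coe_eq_coe_finsetCard]
  refine Set.encard_le_encard fun n hn => ?_
  have hn' : ∀ i, 1 ≤ n i ∧ n i ≤ j := fun i =>
    Finset.mem_Icc.1 (Fintype.mem_piFinset.1 (Finset.mem_coe.1 hn) i)
  refine ⟨fun i => (hn' i).1, hε.trans_le ?_⟩
  calc lam j ^ d = ∏ _i : Fin d, lam j := by simp
    _ ≤ _ := Finset.prod_le_prod (fun _ _ => hj.le) fun i _ => by
        have h := hanti (Set.mem_Ici.2 (hn' i).1)
          (Set.mem_Ici.2 ((hn' i).1.trans (hn' i).2)) (hn' i).2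
        unfold lamKJ
        split_ifs with hni
        · rwa [hni, h1] at h
        · simpa using h

/-- A pointwise bound `log j ≤ C + a_j ^ η / M` bounds the information complexity. -/
theorem exists_infoN_eq_and_log_le {lam γ : ℕ → ℝ} (hanti : AntitoneOn lam (Set.Ici 1))
    (h1 : lam 1 = 1) (hnn : ∀ j, 1 ≤ j → 0 ≤ lam j)
    (hγ0 : ∀ j, 1 ≤ j → 0 < γ j) (hγ1 : ∀ j, 1 ≤ j → γ j ≤ 1)
    {η C M : ℝ} (hη0 : 0 < η) (hη1 : η ≤ 1) (hC : 0 ≤ C) (hM : 0 < M)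
    (hlog : ∀ j : ℕ, 1 ≤ j → 0 < lam j → Real.log j ≤ C + M⁻¹ * Real.log (lam j)⁻¹ ^ η)
    {d : ℕ} (hd : 1 ≤ d) {ε : ℝ} (hε0 : 0 < ε) (hε1 : ε ≤ 1) :
    ∃ N : ℕ, infoN γ lam ε d = N ∧ Real.log (max 1 (N : ℝ)) ≤
      (2 * C + 1) * d + 2 * M⁻¹ * ((d : ℝ) ^ (1 - η) * (2 * Real.log ε⁻¹) ^ η) := by
  have hL : 0 ≤ Real.log ε⁻¹ := Real.log_nonneg ((one_le_inv₀ hε0).2 hε1)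
  set R := C * d + M⁻¹ * ((d : ℝ) ^ (1 - η) * (2 * Real.log ε⁻¹) ^ η) with hR
  have hR0 : 0 ≤ R := by positivity
  obtain ⟨F, hF, hcard⟩ := exists_finset_tuples_prod_le d (Real.exp R)
  have hsub : {n : Fin d → ℕ | (∀ i, 1 ≤ n i) ∧ ε ^ 2 < ∏ i, lamKJ γ lam (i.1 + 1) (n i)} ⊆ F := by
    refine Subset.trans ?_ hF
    rintro n ⟨hn1, hn⟩
    refine ⟨hn1, ?_⟩
    have hle : ε ^ 2 < ∏ i, lam (n i) := by
      refine hn.trans_le (Finset.prod_le_prod (fun i _ => ?_) fun i _ => ?_)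
      · unfold lamKJ
        split_ifs
        · exact zero_le_one
        · exact mul_nonneg (hγ0 _ (by omega)).le (hnn _ (hn1 i))
      · unfold lamKJ
        split_ifs with h
        · rw [h, h1]
        · exact mul_le_of_le_one_left (hnn _ (hn1 i)) (hγ1 _ (by omega))
    have hprod : 0 < ∏ i, lam (n i) := lt_trans (by positivity) hle
    have hpos : ∀ i, 0 < lam (n i) := fun i =>
      (hnn _ (hn1 i)).lt_of_ne' (Finset.prod_ne_zero_iff.1 hprod.ne' i (Finset.mem_univ i))
    have ha : ∀ i, 0 ≤ Real.log (lam (n i))⁻¹ := fun i => by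
      refine Real.log_nonneg ((one_le_inv₀ (hpos i)).2 ?_)
      rw [← h1]
      exact hanti (Set.mem_Ici.2 le_rfl) (Set.mem_Ici.2 (hn1 i)) (hn1 i)
    have hsum : ∑ i, Real.log (lam (n i))⁻¹ ≤ 2 * Real.log ε⁻¹ := by
      have h2 := Real.log_lt_log (by positivity) hle
      rw [Real.log_pow, Real.log_prod fun i _ => (hpos i).ne'] at h2
      simp only [Real.log_inv, Finset.sum_neg_distrib]
      push_cast at h2
      linarith
    have hnpos : ∀ i, (0 : ℝ) < n i := fun i => by exact_mod_cast hn1 i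
    rw [← Real.log_le_iff_le_exp (Finset.prod_pos fun i _ => hnpos i),
      Real.log_prod fun i _ => (hnpos i).ne']
    calc ∑ i, Real.log (n i) ≤ ∑ i, (C + M⁻¹ * Real.log (lam (n i))⁻¹ ^ η) :=
          Finset.sum_le_sum fun i _ => hlog _ (hn1 i) (hpos i)
      _ = C * d + M⁻¹ * ∑ i, Real.log (lam (n i))⁻¹ ^ η := by
          rw [Finset.sum_add_distrib, ← Finset.mul_sum]
          simp [mul_comm]
      _ ≤ R := by
          rw [hR]
          gcongr
          exact sum_rpow_le_card_rpow_mul hd hη0.le hη1 _ ha hsum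
  have hfin := F.finite_toSet.subset hsub
  refine ⟨hfin.toFinset.card, hfin.encard_eq_coe_toFinset_card, ?_⟩
  have hN : (hfin.toFinset.card : ℝ) ≤ 2 ^ d * Real.exp R ^ 2 := by
    refine le_trans ?_ hcard
    exact_mod_cast Finset.card_le_card fun n hn => hsub (hfin.mem_toFinset.1 hn)
  have h2 : (2 : ℝ) ^ d * Real.exp R ^ 2 ≤ Real.exp (d + 2 * R) := by
    rw [Real.exp_add (d : ℝ), ← Real.exp_one_pow, ← Real.exp_nat_mul, Nat.cast_ofNat]
    gcongr
    linarith [Real.add_one_le_exp (1 : ℝ)]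
  have hmax : max 1 (hfin.toFinset.card : ℝ) ≤ Real.exp (d + 2 * R) :=
    max_le (Real.one_le_exp (by positivity)) (hN.trans h2)
  refine ((Real.log_le_iff_le_exp (by positivity)).2 hmax).trans (le_of_eq ?_)
  rw [hR]
  ring

theorem eventually_le_exp_neg_of_expSTWT {lam : ℕ → ℝ} (hanti : AntitoneOn lam (Set.Ici 1)) (h1 : lam 1 = 1)
    {s t : ℝ} (h : ExpSTWT (fun _ => 1) lam s t) (A : ℝ) :
    ∀ᶠ j : ℕ in atTop, lam j ≤ Real.exp (-A) := by
  obtain ⟨T, hT⟩ := h 1 one_pos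
  set B := max (max A (2 * T)) 0 with hB
  have hBA : A ≤ B := (le_max_left _ _).trans (le_max_left _ _)
  have hBT : 2 * T ≤ B := (le_max_right _ _).trans (le_max_left _ _)
  have hB0 : 0 ≤ B := le_max_right _ _
  obtain ⟨N, hN, -⟩ := hT 1 le_rfl (Real.exp (-(B / 2))) (Real.exp_pos _)
    (Real.exp_le_one_iff.2 (by linarith)) (by
      rw [← Real.exp_neg, neg_neg]
      push_cast
      linarith [Real.add_one_le_exp (B / 2)])
  filter_upwards [eventually_gt_atTop N] with j hj
  by_contra! hlt
  have hlt' : Real.exp (-(B / 2)) ^ 2 < lam j ^ 1 := by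
    rw [pow_one, ← Real.exp_nat_mul]
    refine lt_of_le_of_lt (Real.exp_le_exp.2 ?_) hlt
    push_cast
    linarith
  have hle := pow_le_infoN_s9 hanti h1 ((Real.exp_pos _).trans hlt) hlt'
  rw [hN, pow_one] at hle
  have : j ≤ N := by exact_mod_cast hle
  omega

/-- Optimising the dimension: with `d ≈ y ^ (s / (t - s))`, both terms of
`d ^ (t - 1) + d⁻¹ (d y) ^ s` are of order `y ^ η`. -/
theorem exists_dimension {s t η : ℝ} (hs0 : 0 < s) (hs1 : s < 1) (ht : 1 < t)
    (hη : η = s * (t - 1) / (t - s)) {y : ℝ} (hy : 1 ≤ y) :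
    ∃ d : ℕ, 1 ≤ d ∧ (d : ℝ) ^ t + (1 + d * y / 2) ^ s ≤ d * ((2 ^ (t - 1) + 2) * y ^ η) := by
  have hts : 0 < t - s := by linarith
  have hy0 : 0 < y := by linarith
  set r := s / (t - s) with hr
  have hr0 : 0 < r := div_pos hs0 hts
  have hyr : 1 ≤ y ^ r := Real.one_le_rpow hy hr0.le
  have hlow : y ^ r ≤ ⌈y ^ r⌉₊ := Nat.le_ceil _
  have hup : (⌈y ^ r⌉₊ : ℝ) ≤ 2 * y ^ r := by
    linarith [Nat.ceil_lt_add_one (by linarith : 0 ≤ y ^ r)]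
  generalize ⌈y ^ r⌉₊ = d at hlow hup
  have hd1 : (1 : ℝ) ≤ d := hyr.trans hlow
  have hd0 : (0 : ℝ) < d := by linarith
  refine ⟨d, by exact_mod_cast hd1, ?_⟩
  have e1 : r * (t - 1) = η := by rw [hr, hη]; ring
  have e2 : r * (s - 1) + s = η := by rw [hr, hη]; field_simp; ring
  have b1 : (d : ℝ) ^ t ≤ d * (2 ^ (t - 1) * y ^ η) := by
    have h1 : (d : ℝ) ^ (t - 1) ≤ (2 * y ^ r) ^ (t - 1) := by
      gcongr
    rw [Real.mul_rpow (by norm_num) (by linarith), ← Real.rpow_mul hy0.le, e1] at h1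
    calc (d : ℝ) ^ t = d * (d : ℝ) ^ (t - 1) := by
          rw [Real.rpow_sub hd0, Real.rpow_one]; field_simp
      _ ≤ _ := by gcongr
  have b2 : (1 + d * y / 2) ^ s ≤ d * (2 * y ^ η) := by
    have hdy : 1 ≤ d * y := one_le_mul_of_one_le_of_one_le hd1 hy
    have h1 : (d : ℝ) ^ (s - 1) ≤ (y ^ r) ^ (s - 1) :=
      Real.rpow_le_rpow_of_nonpos (by linarith) hlow (by linarith)
    rw [← Real.rpow_mul hy0.le] at h1
    have h2 : (2 : ℝ) ^ s ≤ 2 := by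
      simpa using Real.rpow_le_rpow_of_exponent_le one_le_two hs1.le
    calc (1 + d * y / 2) ^ s ≤ (2 * (d * y)) ^ s := by
          gcongr
          linarith
      _ = d * (2 ^ s * ((d : ℝ) ^ (s - 1) * y ^ s)) := by
          rw [Real.mul_rpow (by norm_num) (by positivity), Real.mul_rpow hd0.le hy0.le,
            Real.rpow_sub hd0, Real.rpow_one]
          field_simp
      _ ≤ d * (2 * (y ^ (r * (s - 1)) * y ^ s)) := by gcongr
      _ = d * (2 * y ^ η) := by rw [← Real.rpow_add hy0, e2]
  linarith

/-- for 0 < s < 1, t > 1 and η = s(t−1)/(t−s): EXP-(s,t)-WT holds for every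
admissible weight sequence γ iff (log λ_j⁻¹)^η / log j → ∞ (understood to hold at j
whenever λ_j = 0). -/
theorem stmt9 (lam : ℕ → ℝ)
    (hlam_anti : AntitoneOn lam (Set.Ici 1)) (hlam1 : lam 1 = 1) (hlam2 : 0 < lam 2)
    (hlam_nonneg : ∀ j, 1 ≤ j → 0 ≤ lam j)
    (s t η : ℝ) (hs0 : 0 < s) (hs1 : s < 1) (ht : 1 < t) (hη : η = s * (t - 1) / (t - s)) :
    (∀ γ : ℕ → ℝ, AntitoneOn γ (Set.Ici 1) → (∀ j, 1 ≤ j → 0 < γ j) →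
        (∀ j, 1 ≤ j → γ j ≤ 1) → ExpSTWT γ lam s t) ↔
      (∀ M : ℝ, 0 < M → ∀ᶠ j : ℕ in atTop,
        lam j = 0 ∨ M * Real.log j < Real.log ((lam j)⁻¹) ^ η) := by
  have hη0 := eta_pos hs0 hs1 ht hη
  have hη1 := eta_lt_one hs1 ht hη
  constructor
  · intro h M hM
    have hwt := h (fun _ => 1) (fun _ _ _ _ _ => le_rfl) (fun _ _ => one_pos) (fun _ _ => le_rfl)
    set c : ℝ := 2 ^ (t - 1) + 2 with hc
    have hc0 : 0 < c := by positivity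
    obtain ⟨T, hT⟩ := hwt (1 / (2 * M * c)) (by positivity)
    filter_upwards [eventually_le_exp_neg_of_expSTWT hlam_anti hlam1 hwt (max 1 (2 * T)),
      eventually_ge_atTop 1] with j hj hj1
    rcases (hlam_nonneg j hj1).eq_or_lt with h0 | hpos
    · exact Or.inl h0.symm
    right
    set a := Real.log (lam j)⁻¹ with ha
    have hexp : lam j = Real.exp (-a) := by
      rw [ha, Real.log_inv, neg_neg, Real.exp_log hpos]
    have hamax : max 1 (2 * T) ≤ a := by
      rw [hexp, Real.exp_le_exp] at hj
      linarith
    have ha1 : 1 ≤ a := (le_max_left _ _).trans hamax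
    have haT : 2 * T ≤ a := (le_max_right _ _).trans hamax
    obtain ⟨d, hd, hdim⟩ := exists_dimension hs0 hs1 ht hη (y := a + 1) (by linarith)
    have hd1 : (1 : ℝ) ≤ d := by exact_mod_cast hd
    have hd0 : (0 : ℝ) < d := by linarith
    have hinv : (Real.exp (-(d * (a + 1) / 2)))⁻¹ = Real.exp (d * (a + 1) / 2) := by
      rw [← Real.exp_neg, neg_neg]
    obtain ⟨N, hN, hlt⟩ := hT d hd (Real.exp (-(d * (a + 1) / 2))) (Real.exp_pos _)
      (Real.exp_le_one_iff.2 (by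
        have : 0 ≤ d * (a + 1) := by positivity
        linarith)) (by
      rw [hinv]
      nlinarith [Real.add_one_le_exp (d * (a + 1) / 2)])
    have hbox := pow_le_infoN_s9 (d := d) (ε := Real.exp (-(d * (a + 1) / 2))) hlam_anti hlam1 hpos (by
      rw [hexp, ← Real.exp_nat_mul, ← Real.exp_nat_mul, Real.exp_lt_exp]
      push_cast
      linarith)
    rw [hN] at hbox
    have hjN : ((j : ℝ) ^ d) ≤ N := by exact_mod_cast hbox
    have hj0 : (0 : ℝ) < j := by exact_mod_cast hj1
    have hlogN : d * Real.log j ≤ Real.log (max 1 (N : ℝ)) := by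
      rw [← Real.log_pow]
      exact Real.log_le_log (by positivity) (hjN.trans (le_max_right _ _))
    rw [hinv, Real.log_exp, div_lt_iff₀ (by positivity)] at hlt
    have hy : (a + 1) ^ η ≤ 2 * a ^ η := by
      calc (a + 1) ^ η ≤ (2 * a) ^ η := by
            gcongr
            linarith
        _ = 2 ^ η * a ^ η := Real.mul_rpow (by norm_num) (by linarith)
        _ ≤ 2 * a ^ η := by
            gcongr
            simpa using Real.rpow_le_rpow_of_exponent_le one_le_two hη1.le
    have hfin : d * Real.log j < d * (M⁻¹ * a ^ η) := by
      calc d * Real.log j < 1 / (2 * M * c) * ((d : ℝ) ^ t + (1 + d * (a + 1) / 2) ^ s) :=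
            hlogN.trans_lt hlt
        _ ≤ 1 / (2 * M * c) * (d * (c * (2 * a ^ η))) := by
            gcongr
            exact hdim.trans (by gcongr)
        _ = d * (M⁻¹ * a ^ η) := by field_simp
    have h3 := lt_of_mul_lt_mul_left hfin hd0.le
    rwa [lt_inv_mul_iff₀ hM] at h3
  · intro h γ _ hγ0 hγ1 δ hδ
    obtain ⟨J, hJ⟩ := eventually_atTop.1 (h (8 / δ) (by positivity))
    have hlog : ∀ j : ℕ, 1 ≤ j → 0 < lam j →
        Real.log j ≤ Real.log (J + 1) + (8 / δ)⁻¹ * Real.log (lam j)⁻¹ ^ η := by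
      intro j hj hpos
      have hj0 : (0 : ℝ) < j := by exact_mod_cast hj
      have hJ0 : 0 ≤ Real.log ((J : ℝ) + 1) := Real.log_nonneg (by simp)
      have ha : 0 ≤ Real.log (lam j)⁻¹ := by
        refine Real.log_nonneg ((one_le_inv₀ hpos).2 ?_)
        rw [← hlam1]
        exact hlam_anti (Set.mem_Ici.2 le_rfl) (Set.mem_Ici.2 hj) hj
      rcases le_total J j with hle | hle
      · have h2 := ((hJ j hle).resolve_left hpos.ne').le
        rw [← le_inv_mul_iff₀ (by positivity)] at h2
        linarith
      · have h2 : Real.log j ≤ Real.log (J + 1) := by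
          refine Real.log_le_log hj0 ?_
          exact_mod_cast hle.trans (Nat.le_succ J)
        have h3 : 0 ≤ (8 / δ)⁻¹ * Real.log (lam j)⁻¹ ^ η := by positivity
        linarith
    obtain ⟨T, hT⟩ := exists_linear_lt hs0 ht (2 * Real.log (J + 1) + 1) (half_pos hδ)
    refine ⟨T, fun d hd ε hε0 hε1 hTd => ?_⟩
    obtain ⟨N, hN, hNlog⟩ := exists_infoN_eq_and_log_le hlam_anti hlam1 hlam_nonneg hγ0 hγ1
      hη0 hη1.le (Real.log_nonneg (by simp)) (by positivity) hlog hd hε0 hε1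
    refine ⟨N, hN, ?_⟩
    have hL : 0 ≤ Real.log ε⁻¹ := Real.log_nonneg ((one_le_inv₀ hε0).2 hε1)
    have hd0 : (0 : ℝ) < d := by exact_mod_cast hd
    rw [div_lt_iff₀ (by positivity)]
    have hlin := hT d hd ε hε0 hε1 hTd
    have hY : (d : ℝ) ^ (1 - η) * (2 * Real.log ε⁻¹) ^ η ≤
        2 * ((d : ℝ) ^ t + (1 + Real.log ε⁻¹) ^ s) := by
      calc (d : ℝ) ^ (1 - η) * (2 * Real.log ε⁻¹) ^ η
          ≤ (d : ℝ) ^ (1 - η) * (2 * (1 + Real.log ε⁻¹) ^ η) := by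
            gcongr
            calc (2 * Real.log ε⁻¹) ^ η ≤ (2 * (1 + Real.log ε⁻¹)) ^ η := by
                  gcongr
                  linarith
              _ = 2 ^ η * (1 + Real.log ε⁻¹) ^ η :=
                  Real.mul_rpow (by norm_num) (by linarith)
              _ ≤ 2 * (1 + Real.log ε⁻¹) ^ η := by
                  gcongr
                  simpa using Real.rpow_le_rpow_of_exponent_le one_le_two hη1.le
        _ = 2 * ((d : ℝ) ^ (1 - η) * (1 + Real.log ε⁻¹) ^ η) := by ring
        _ ≤ _ := by
            gcongr
            exact rpow_mul_rpow_le_add_rpow hs1 ht hη hd0.le (by linarith)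
    have hM : 2 * (8 / δ)⁻¹ * ((d : ℝ) ^ (1 - η) * (2 * Real.log ε⁻¹) ^ η) ≤
        2 * (8 / δ)⁻¹ * (2 * ((d : ℝ) ^ t + (1 + Real.log ε⁻¹) ^ s)) := by gcongr
    have hE : 2 * (8 / δ)⁻¹ * (2 * ((d : ℝ) ^ t + (1 + Real.log ε⁻¹) ^ s)) =
        δ / 2 * ((d : ℝ) ^ t + (1 + Real.log ε⁻¹) ^ s) := by
      field_simp
      ring
    linarith
end
end
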